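/- arXiv:0803.3933 — 6 statements merged into one kernel-verified Lean document; each statement's English description precedes it below -/
import Mathlib

section
/- Let K be a k-arc in the projective plane PG(2,q) over the finite field F_q. Then every blocking set of the secants of K has size at least k−1. -/
open scoped LinearAlgebra.Projectivization

/-- The projective plane over a field `F`. -/
abbrev PG2 (F : Type*) [Field F] := Projectivization F (Fin 3 → F)

variable {F : Type*} [Field F]

/-- A line of `PG2 F`: the zero set of a nonzero linear form. -/
def IsLine (l : Set (PG2 F)) : Prop :=
  ∃ f : (Fin 3 → F) →ₗ[F] F, f ≠ 0 ∧ l = {P : PG2 F | f P.rep = 0}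

/-- Three points of `PG2 F` are collinear if some line contains them all. -/
def Collinear3 (A B C : PG2 F) : Prop :=
  ∃ l : Set (PG2 F), IsLine l ∧ A ∈ l ∧ B ∈ l ∧ C ∈ l

/-- An arc: a set of points no three of which are collinear, i.e. every line
meets it in at most two points. -/
def IsArc (K : Set (PG2 F)) : Prop :=
  ∀ l : Set (PG2 F), IsLine l → (K ∩ l).ncard ≤ 2

/-- A secant (chord) of `K`: a line containing at least two points of `K`. -/
def IsSecant (K l : Set (PG2 F)) : Prop :=
  IsLine l ∧ 2 ≤ (K ∩ l).ncard

/-- A blocking set of the secants of `K`: a set of points disjoint from `K`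
meeting every secant of `K`. -/
def IsBlockingSet (K B : Set (PG2 F)) : Prop :=
  B ∩ K = ∅ ∧ ∀ l : Set (PG2 F), IsSecant K l → (B ∩ l).Nonempty

/-- The focus set of `K` on `l`: the points of `l` lying on some secant of `K`. -/
def FocusSet (K l : Set (PG2 F)) : Set (PG2 F) :=
  {P : PG2 F | P ∈ l ∧ ∃ m : Set (PG2 F), IsSecant K m ∧ P ∈ m}

/-- `K` is hyperfocused on the exterior line `l` if the secants of `K` meet `l`
in exactly `|K| - 1` points. -/
def Hyperfocused (K l : Set (PG2 F)) : Prop :=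
  IsLine l ∧ K ∩ l = ∅ ∧ (FocusSet K l).ncard = K.ncard - 1

/-- `K` is sharply focused on the exterior line `l` if the secants of `K` meet `l`
in exactly `|K|` points. -/
def SharplyFocused (K l : Set (PG2 F)) : Prop :=
  IsLine l ∧ K ∩ l = ∅ ∧ (FocusSet K l).ncard = K.ncard

/-- A conic: the zero set of an irreducible homogeneous quadratic form. -/
def IsConic (C : Set (PG2 F)) : Prop :=
  ∃ Q : MvPolynomial (Fin 3) F, Q.IsHomogeneous 2 ∧ Irreducible Q ∧
    C = {P : PG2 F | MvPolynomial.eval P.rep Q = 0}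

/-- A tangent line to a point set `C`: a line meeting `C` in exactly one point. -/
def IsTangentLine (C l : Set (PG2 F)) : Prop :=
  IsLine l ∧ (C ∩ l).ncard = 1

/-- A projectivity of `PG2 F`: a map induced by a linear automorphism. -/
def IsProjectivity (φ : PG2 F → PG2 F) : Prop :=
  ∃ g : (Fin 3 → F) ≃ₗ[F] (Fin 3 → F),
    ∀ P : PG2 F, φ P = Projectivization.map g.toLinearMap g.injective P

lemma mk3_ne_zero {a b c : F} (h : a ≠ 0 ∨ b ≠ 0 ∨ c ≠ 0) :
    (![a, b, c] : Fin 3 → F) ≠ 0 := by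
  intro hv
  rcases h with h | h | h
  · exact h (by simpa using congrFun hv 0)
  · exact h (by simpa using congrFun hv 1)
  · exact h (by simpa using congrFun hv 2)

/-- The point of `PG2 F` with homogeneous coordinates `(a, b, c)`. -/
def pt (a b c : F) (h : (![a, b, c] : Fin 3 → F) ≠ 0) : PG2 F :=
  Projectivization.mk F ![a, b, c] h

/-- The linear automorphism `(X₁, X₂, X₃) ↦ (X₁ + a₁·X₃, X₂ + a₂·X₃, X₃)`. -/
def tEquiv (A : F × F) : (Fin 3 → F) ≃ₗ[F] (Fin 3 → F) where
  toFun v := ![v 0 + A.1 * v 2, v 1 + A.2 * v 2, v 2]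
  invFun v := ![v 0 - A.1 * v 2, v 1 - A.2 * v 2, v 2]
  left_inv v := by funext i; fin_cases i <;> simp
  right_inv v := by funext i; fin_cases i <;> simp
  map_add' u v := by funext i; fin_cases i <;> simp <;> ring
  map_smul' c v := by funext i; fin_cases i <;> simp <;> ring

/-- The projectivity `φ_A` of `PG2 F` induced by `tEquiv A`. -/
def tφ (A : F × F) : PG2 F → PG2 F :=
  Projectivization.map (tEquiv A).toLinearMap (tEquiv A).injective

/-- The orbit `K_G(P)` of a point `P` under the translation group `T_G`. -/
def tOrbit (G : AddSubgroup (F × F)) (P : PG2 F) : Set (PG2 F) :=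
  {Q : PG2 F | ∃ A ∈ G, Q = tφ A P}

/-- A translation arc: an arc which is an orbit `K_G(P)`. -/
def IsTranslationArc (K : Set (PG2 F)) : Prop :=
  IsArc K ∧ ∃ (G : AddSubgroup (F × F)) (P : PG2 F), K = tOrbit G P

lemma isLine_iff_exists_orthogonal {l : Set (PG2 F)} :
    IsLine l ↔ ∃ m : PG2 F, l = {P | P.orthogonal m} := by
  have key (P : PG2 F) (v : Fin 3 → F) (hv : v ≠ 0) :
      P.orthogonal (Projectivization.mk F v hv) ↔ dotProductEquiv F (Fin 3) v P.rep = 0 := by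
    conv_lhs => rw [← P.mk_rep]
    rw [Projectivization.orthogonal_mk, dotProduct_comm]
    rfl
  constructor
  · rintro ⟨f, hf, rfl⟩
    obtain ⟨v, rfl⟩ := (dotProductEquiv F (Fin 3)).surjective f
    have hv : v ≠ 0 := by
      rintro rfl
      exact hf (map_zero _)
    exact ⟨Projectivization.mk F v hv, Set.ext fun P => (key P v hv).symm⟩
  · rintro ⟨m, rfl⟩
    induction m using Projectivization.ind with | h v hv =>
    exact ⟨dotProductEquiv F (Fin 3) v, by simpa using hv, Set.ext fun P => key P v hv⟩

lemma exists_isLine_mem_mem {P Q : PG2 F} (h : P ≠ Q) :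
    ∃ l : Set (PG2 F), IsLine l ∧ P ∈ l ∧ Q ∈ l := by
  classical
  exact ⟨_, isLine_iff_exists_orthogonal.2 ⟨Projectivization.cross P Q, rfl⟩,
    Projectivization.orthogonal_cross_left h, Projectivization.orthogonal_cross_right h⟩

lemma IsLine.eq_of_mem {l m : Set (PG2 F)} (hl : IsLine l) (hm : IsLine m) {P Q : PG2 F}
    (h : P ≠ Q) (hPl : P ∈ l) (hQl : Q ∈ l) (hPm : P ∈ m) (hQm : Q ∈ m) : l = m := by
  classical
  obtain ⟨a, rfl⟩ := isLine_iff_exists_orthogonal.1 hl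
  obtain ⟨b, rfl⟩ := isLine_iff_exists_orthogonal.1 hm
  have hab : a = b := (Configuration.Nondegenerate.eq_or_eq (P := PG2 F) (L := PG2 F)
    hPl hQl hPm hQm).resolve_left h
  rw [hab]

/-- every blocking set of the secants of a `k`-arc has size at
least `k - 1`. -/
theorem blockingSet_card_ge {F : Type*} [Field F] [Fintype F] (k : ℕ)
    (K B : Set (PG2 F)) (hK : IsArc K) (hKcard : K.ncard = k)
    (hB : IsBlockingSet K B) :
    k - 1 ≤ B.ncard := by
  rcases K.eq_empty_or_nonempty with rfl | ⟨P, hP⟩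
  · simp [← hKcard]
  have hsec : ∀ Q ∈ K \ {P}, ∃ R ∈ B, ∃ l : Set (PG2 F), IsLine l ∧ P ∈ l ∧ Q ∈ l ∧ R ∈ l := by
    rintro Q ⟨hQ, hQP⟩
    obtain ⟨l, hl, hPl, hQl⟩ := exists_isLine_mem_mem (Ne.symm hQP)
    obtain ⟨R, hRB, hRl⟩ := hB.2 l
      ⟨hl, (Set.one_lt_ncard).2 ⟨P, ⟨hP, hPl⟩, Q, ⟨hQ, hQl⟩, Ne.symm hQP⟩⟩
    exact ⟨R, hRB, l, hl, hPl, hQl, hRl⟩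
  choose! b hbB l hl hPl hQl hbl using hsec
  rw [← hKcard, ← Set.ncard_sdiff_singleton_of_mem hP]
  refine Set.ncard_le_ncard_of_injOn b hbB fun Q hQ Q' hQ' hQQ' => ?_
  by_contra hne
  have hPb : P ≠ b Q := fun h =>
    (Set.disjoint_iff_inter_eq_empty.2 hB.1).ne_of_mem (hbB Q hQ) hP h.symm
  have hll : l Q = l Q' := (hl Q hQ).eq_of_mem (hl Q' hQ') hPb (hPl Q hQ) (hbl Q hQ)
    (hPl Q' hQ') (hQQ' ▸ hbl Q' hQ')
  have hthree : 2 < (K ∩ l Q).ncard := (Set.two_lt_ncard).2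
    ⟨P, ⟨hP, hPl Q hQ⟩, Q, ⟨hQ.1, hQl Q hQ⟩, Q', ⟨hQ'.1, hll ▸ hQl Q' hQ'⟩,
      Ne.symm hQ.2, Ne.symm hQ'.2, hne⟩
  exact hthree.not_ge (hK _ (hl Q hQ))
end

section
/- If K is a hyperfocused k-arc in PG(2,q) with k ≥ 4, then q is even. -/
open scoped LinearAlgebra.Projectivization

variable {F : Type*} [Field F]

open Finset in
/-- Reindexing a product along an injection of `K \ {A}` onto `D`, with two further points
removed. -/
lemma prod_sdiff_eq_of_injOn {α M : Type*} [DecidableEq α] [CommMonoid M] {K D : Finset α}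
    {A B C : α} (hA : A ∈ K) (hB : B ∈ K.erase A) (hC : C ∈ K.erase A) (φ : α → α)
    (hmaps : ∀ Q ∈ K.erase A, φ Q ∈ D) (hinj : Set.InjOn φ (K.erase A))
    (hcard : D.card = K.card - 1) (g : α → M) (hg : ∀ Q ∈ K.erase A, g (φ Q) = g Q) :
    ∏ Q ∈ (K.erase A) \ {B, C}, g Q = ∏ R ∈ D \ {φ B, φ C}, g R := by
  have himage : (K.erase A).image φ = D := by
    apply eq_of_subset_of_card_le
    · exact image_subset_iff.2 hmaps
    · rw [card_image_of_injOn hinj, card_erase_of_mem hA, hcard]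
  have hsub : ((K.erase A) \ {B, C}).image φ = D \ {φ B, φ C} := by
    rw [← himage]
    ext R
    simp only [mem_image, mem_sdiff, mem_insert, mem_singleton]
    constructor
    · rintro ⟨Q, ⟨hQ, hne⟩, rfl⟩
      refine ⟨⟨Q, hQ, rfl⟩, fun h => hne ?_⟩
      exact h.imp (fun h => hinj hQ hB h) (fun h => hinj hQ hC h)
    · rintro ⟨⟨Q, hQ, rfl⟩, hne⟩
      exact ⟨Q, ⟨hQ, fun h => hne (h.imp (congrArg φ) (congrArg φ))⟩, rfl⟩
  rw [← hsub, prod_image (hinj.mono (by exact_mod_cast sdiff_subset))]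
  exact prod_congr rfl fun Q hQ => (hg Q (mem_sdiff.1 hQ).1).symm

/-- The determinant of the matrix with rows `u`, `v`, `w`. -/
def bracket (u v w : Fin 3 → F) : F := (Matrix.of ![u, v, w]).det

lemma bracket_eq (u v w : Fin 3 → F) : bracket u v w =
    u 0 * (v 1 * w 2 - v 2 * w 1) - u 1 * (v 0 * w 2 - v 2 * w 0)
      + u 2 * (v 0 * w 1 - v 1 * w 0) := by
  simp [bracket, Matrix.det_fin_three]
  ring

lemma exists_linearMap_of_bracket_eq_zero {u v w : Fin 3 → F} (h : bracket u v w = 0) :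
    ∃ f : (Fin 3 → F) →ₗ[F] F, f ≠ 0 ∧ f u = 0 ∧ f v = 0 ∧ f w = 0 := by
  obtain ⟨a, ha, hm⟩ := Matrix.exists_mulVec_eq_zero_iff.2 h
  refine ⟨dotProductBilin F F a, fun h0 => ha ?_, ?_, ?_, ?_⟩
  · funext i
    simpa using congrArg (fun f : (Fin 3 → F) →ₗ[F] F => f (Pi.single i 1)) h0
  · simpa [Matrix.mulVec, dotProduct_comm] using congrFun hm 0
  · simpa [Matrix.mulVec, dotProduct_comm] using congrFun hm 1
  · simpa [Matrix.mulVec, dotProduct_comm] using congrFun hm 2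

lemma PG2.eq_of_rep_eq_smul {P Q : PG2 F} {c : F} (h : P.rep = c • Q.rep) : P = Q := by
  rw [← P.mk_rep, ← Q.mk_rep, Projectivization.mk_eq_mk_iff']
  exact ⟨c, h.symm⟩

lemma IsArc.bracket_ne_zero [Finite F] {K : Set (PG2 F)} (hK : IsArc K) {A B C : PG2 F}
    (hA : A ∈ K) (hB : B ∈ K) (hC : C ∈ K) (hAB : A ≠ B) (hAC : A ≠ C) (hBC : B ≠ C) :
    bracket A.rep B.rep C.rep ≠ 0 := by
  intro h
  obtain ⟨f, hf, h1, h2, h3⟩ := exists_linearMap_of_bracket_eq_zero h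
  have hle := hK {P | f P.rep = 0} ⟨f, hf, rfl⟩
  have hsub : ({A, B, C} : Set (PG2 F)) ⊆ K ∩ {P | f P.rep = 0} := by
    rintro P (rfl | rfl | rfl)
    exacts [⟨hA, h1⟩, ⟨hB, h2⟩, ⟨hC, h3⟩]
  have := Set.ncard_le_ncard hsub (Set.toFinite _)
  rw [Set.ncard_eq_three.2 ⟨A, B, C, hAB, hAC, hBC, rfl⟩] at this
  omega

/-- The chord through two points of `K` meets a line with equation `f` in a focus. -/
lemma exists_focus_on_chord [Finite F] {K : Set (PG2 F)} {f : (Fin 3 → F) →ₗ[F] F}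
    {A Q : PG2 F} (hA : A ∈ K) (hQ : Q ∈ K) (hAQ : Q ≠ A) (hfA : f A.rep ≠ 0) :
    ∃ R ∈ FocusSet K {P | f P.rep = 0}, ∃ c : F, c ≠ 0 ∧
      R.rep = c • (f A.rep • Q.rep - f Q.rep • A.rep) := by
  have hv : f A.rep • Q.rep - f Q.rep • A.rep ≠ 0 := by
    intro h
    apply hAQ
    apply PG2.eq_of_rep_eq_smul (c := (f A.rep)⁻¹ * f Q.rep)
    rw [mul_smul, ← sub_eq_zero.1 h, smul_smul, inv_mul_cancel₀ hfA, one_smul]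
  obtain ⟨c, hc⟩ := Projectivization.exists_smul_eq_mk_rep F _ hv
  obtain ⟨h, hh, hhA, hhQ, -⟩ := exists_linearMap_of_bracket_eq_zero
    (u := A.rep) (v := Q.rep) (w := 0) (by simp [bracket_eq])
  refine ⟨Projectivization.mk F _ hv, ⟨?_, {P | h P.rep = 0}, ⟨⟨h, hh, rfl⟩, ?_⟩, ?_⟩,
    c, c.ne_zero, hc.symm⟩
  · simp only [Set.mem_ofPred_eq, ← hc, Units.smul_def, map_smul, map_sub, smul_eq_mul]
    ring
  · have hsub : ({Q, A} : Set (PG2 F)) ⊆ K ∩ {P | h P.rep = 0} := by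
      rintro P (rfl | rfl)
      exacts [⟨hQ, hhQ⟩, ⟨hA, hhA⟩]
    have := Set.ncard_le_ncard hsub (Set.toFinite _)
    rwa [Set.ncard_pair hAQ] at this
  · simp [← hc, Units.smul_def, hhA, hhQ]

/-- if there is a hyperfocused `k`-arc with `k ≥ 4` in `PG(2,q)`,
then `q` is even. -/
theorem even_of_hyperfocused {F : Type*} [Field F] [Fintype F] (k : ℕ) (hk : 4 ≤ k)
    (K l : Set (PG2 F)) (harc : IsArc K) (hcard : K.ncard = k)
    (hhf : Hyperfocused K l) :
    Even (Fintype.card F) := by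
  classical
  obtain ⟨⟨f, -, rfl⟩, hext, hD⟩ := hhf
  have hf : ∀ A ∈ K, f A.rep ≠ 0 := fun A hA h =>
    (Set.eq_empty_iff_forall_notMem.1 hext A) ⟨hA, h⟩
  generalize hDS : FocusSet K {P | f P.rep = 0} = S at hD
  obtain ⟨D, rfl⟩ := (Set.toFinite S).exists_finset_coe
  have hex : ∀ A Q : PG2 F, ∃ R : PG2 F, A ∈ K → Q ∈ K → Q ≠ A →
      R ∈ D ∧ ∃ c : F, c ≠ 0 ∧ R.rep = c • (f A.rep • Q.rep - f Q.rep • A.rep) := by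
    intro A Q
    by_cases h : A ∈ K ∧ Q ∈ K ∧ Q ≠ A
    · obtain ⟨R, hR, hc⟩ := exists_focus_on_chord h.1 h.2.1 h.2.2 (hf A h.1)
      rw [hDS] at hR
      exact ⟨R, fun _ _ _ => ⟨by exact_mod_cast hR, hc⟩⟩
    · exact ⟨A, fun h1 h2 h3 => absurd ⟨h1, h2, h3⟩ h⟩
  choose φ hφ using hex
  have hinj : ∀ A ∈ K, ∀ Q ∈ K, ∀ Q' ∈ K, Q ≠ A → Q' ≠ A → φ A Q = φ A Q' → Q = Q' := by
    intro A hA Q hQ Q' hQ' hQA hQA' h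
    by_contra hne
    obtain ⟨-, c, hc, h1⟩ := hφ A Q hA hQ hQA
    obtain ⟨-, c', -, h2⟩ := hφ A Q' hA hQ' hQA'
    rw [h, h2] at h1
    have h0 := congrArg (fun v => bracket A.rep v Q'.rep) h1
    have e : c * f A.rep * bracket A.rep Q.rep Q'.rep = 0 := by
      simp only [bracket_eq, Pi.smul_apply, Pi.sub_apply, smul_eq_mul] at h0 ⊢
      linear_combination -h0
    exact mul_ne_zero (mul_ne_zero hc (hf A hA))
      (harc.bracket_ne_zero hA hQ hQ' hQA.symm hQA'.symm hne) e
  have hsymm : ∀ A ∈ K, ∀ B ∈ K, A ≠ B → φ A B = φ B A := by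
    intro A hA B hB hAB
    obtain ⟨-, c, hc, h1⟩ := hφ A B hA hB hAB.symm
    obtain ⟨-, c', hc', h2⟩ := hφ B A hB hA hAB
    apply PG2.eq_of_rep_eq_smul (c := -c * c'⁻¹)
    rw [h1, h2, smul_smul, mul_assoc, inv_mul_cancel₀ hc', mul_one, neg_smul, ← smul_neg,
      neg_sub]
  have hbr : ∀ A ∈ K, ∀ Q ∈ K, Q ≠ A → ∃ c : F, c ≠ 0 ∧ ∀ v : Fin 3 → F,
      bracket A.rep v (φ A Q).rep = c * bracket A.rep v Q.rep ∧
      bracket v A.rep (φ A Q).rep = c * bracket v A.rep Q.rep := by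
    intro A hA Q hQ hQA
    obtain ⟨-, c, hc, h1⟩ := hφ A Q hA hQ hQA
    refine ⟨c * f A.rep, mul_ne_zero hc (hf A hA), fun v => ?_⟩
    rw [h1]
    simp only [bracket_eq, Pi.smul_apply, Pi.sub_apply, smul_eq_mul]
    constructor <;> ring
  obtain ⟨A, hA, B, hB, C, hC, hAB, hAC, hBC⟩ :
      ∃ A ∈ K, ∃ B ∈ K, ∃ C ∈ K, A ≠ B ∧ A ≠ C ∧ B ≠ C := by
    obtain ⟨A, B, C, hA, hB, hC, h⟩ := (Set.two_lt_ncard_iff (Set.toFinite K)).1 (by omega)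
    exact ⟨A, hA, B, hB, C, hC, h⟩
  obtain ⟨K, rfl⟩ := (Set.toFinite K).exists_finset_coe
  simp only [Finset.mem_coe, Set.ncard_coe_finset] at *
  let g : PG2 F → PG2 F → PG2 F → PG2 F → F := fun X Y Z P =>
    bracket X.rep Y.rep P.rep / bracket Z.rep X.rep P.rep
  have hvertex : ∀ X ∈ K, ∀ Y ∈ K, ∀ Z ∈ K, X ≠ Y → X ≠ Z → Y ≠ Z →
      ∏ Q ∈ K \ {X, Y, Z}, g X Y Z Q =
        -(f Y.rep / f Z.rep) * ∏ R ∈ D \ {φ X Y, φ Y Z, φ Z X}, g X Y Z R := by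
    intro X hX Y hY Z hZ hXY hXZ hYZ
    have key := prod_sdiff_eq_of_injOn hX (Finset.mem_erase.2 ⟨hXY.symm, hY⟩)
      (Finset.mem_erase.2 ⟨hXZ.symm, hZ⟩) (φ X)
      (fun Q hQ => (hφ X Q hX (Finset.mem_of_mem_erase hQ) (Finset.ne_of_mem_erase hQ)).1)
      (fun Q hQ Q' hQ' h => by
        simp only [Finset.mem_coe, Finset.mem_erase] at hQ hQ'
        exact hinj X hX Q hQ.2 Q' hQ'.2 hQ.1 hQ'.1 h)
      hD (g X Y Z) (fun Q hQ => by
        obtain ⟨c, hc, h⟩ := hbr X hX Q (Finset.mem_of_mem_erase hQ) (Finset.ne_of_mem_erase hQ)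
        simp only [g]
        rw [(h _).1, (h _).2, mul_div_mul_left _ _ hc])
    have e1 : K \ {X, Y, Z} = (K.erase X) \ {Y, Z} := by
      ext
      simp only [Finset.mem_sdiff, Finset.mem_insert, Finset.mem_singleton, Finset.mem_erase]
      tauto
    obtain ⟨hmem, c, hc, hrep⟩ := hφ Y Z hY hZ hYZ.symm
    have e2 : D \ {φ X Y, φ X Z} = insert (φ Y Z) (D \ {φ X Y, φ Y Z, φ Z X}) := by
      have n1 : φ Y Z ≠ φ X Y := by
        rw [hsymm X hX Y hY hXY]
        exact fun h => hXZ (hinj Y hY Z hZ X hX hYZ.symm hXY h).symm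
      have n2 : φ Y Z ≠ φ X Z := by
        rw [hsymm X hX Z hZ hXZ, hsymm Y hY Z hZ hYZ]
        exact fun h => hXY (hinj Z hZ Y hY X hX hYZ hXZ h).symm
      rw [hsymm Z hZ X hX hXZ.symm]
      ext R
      simp only [Finset.mem_sdiff, Finset.mem_insert, Finset.mem_singleton]
      by_cases hR : R = φ Y Z
      · subst hR
        tauto
      · tauto
    rw [e1, key, e2, Finset.prod_insert (by simp)]
    congr 1
    have hne := harc.bracket_ne_zero hX hY hZ hXY hXZ hYZ
    have hfZ := hf Z hZ
    have h1 : bracket X.rep Y.rep (φ Y Z).rep =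
        c * f Y.rep * bracket X.rep Y.rep Z.rep := by
      rw [hrep]
      simp only [bracket_eq, Pi.smul_apply, Pi.sub_apply, smul_eq_mul]
      ring
    have h2 : bracket Z.rep X.rep (φ Y Z).rep =
        -(c * f Z.rep * bracket X.rep Y.rep Z.rep) := by
      rw [hrep]
      simp only [bracket_eq, Pi.smul_apply, Pi.sub_apply, smul_eq_mul]
      ring
    simp only [g, h1, h2]
    field_simp
  have hA' := hvertex A hA B hB C hC hAB hAC hBC
  have hB' := hvertex B hB C hC A hA hBC hAB.symm hAC.symm
  have hC' := hvertex C hC A hA B hB hAC.symm hBC.symm hAB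
  have rot : ∀ X Y Z : PG2 F, ({Y, Z, X} : Finset (PG2 F)) = {X, Y, Z} := by
    intro X Y Z
    ext
    simp only [Finset.mem_insert, Finset.mem_singleton]
    tauto
  rw [rot A B C, rot (φ A B) (φ B C) (φ C A)] at hB'
  rw [← rot C A B, ← rot (φ C A) (φ A B) (φ B C)] at hC'
  have ceva : ∀ P : PG2 F, bracket A.rep B.rep P.rep ≠ 0 → bracket B.rep C.rep P.rep ≠ 0 →
      bracket C.rep A.rep P.rep ≠ 0 → g A B C P * g B C A P * g C A B P = 1 := by
    intro P h1 h2 h3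
    simp only [g]
    field_simp
  have hside : ∀ X ∈ K, ∀ Y ∈ K, X ≠ Y → ∀ R ∈ D, R ≠ φ X Y →
      bracket X.rep Y.rep R.rep ≠ 0 := by
    intro X hX Y hY hXY R hR hne
    obtain ⟨Q, hQ, rfl⟩ := Finset.surj_on_of_inj_on_of_card_le (s := K.erase X) (t := D)
      (fun Q _ => φ X Q)
      (fun Q hQ => (hφ X Q hX (Finset.mem_of_mem_erase hQ) (Finset.ne_of_mem_erase hQ)).1)
      (fun Q Q' hQ hQ' h => hinj X hX Q (Finset.mem_of_mem_erase hQ) Q'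
        (Finset.mem_of_mem_erase hQ') (Finset.ne_of_mem_erase hQ) (Finset.ne_of_mem_erase hQ') h)
      (by rw [Finset.card_erase_of_mem hX, hD]) R hR
    obtain ⟨hQX, hQK⟩ := Finset.mem_erase.1 hQ
    obtain ⟨c, hc, h⟩ := hbr X hX Q hQK hQX
    rw [(h _).1]
    refine mul_ne_zero hc (harc.bracket_ne_zero hX hY hQK hXY hQX.symm ?_)
    rintro rfl
    exact hne rfl
  have hK1 : (∏ Q ∈ K \ {A, B, C}, g A B C Q) * (∏ Q ∈ K \ {A, B, C}, g B C A Q) *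
      (∏ Q ∈ K \ {A, B, C}, g C A B Q) = 1 := by
    rw [← Finset.prod_mul_distrib, ← Finset.prod_mul_distrib]
    refine Finset.prod_eq_one fun Q hQ => ?_
    simp only [Finset.mem_sdiff, Finset.mem_insert, Finset.mem_singleton, not_or] at hQ
    obtain ⟨hQ, hQA, hQB, hQC⟩ := hQ
    exact ceva Q (harc.bracket_ne_zero hA hB hQ hAB (Ne.symm hQA) (Ne.symm hQB))
      (harc.bracket_ne_zero hB hC hQ hBC (Ne.symm hQB) (Ne.symm hQC))
      (harc.bracket_ne_zero hC hA hQ hAC.symm (Ne.symm hQC) (Ne.symm hQA))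
  have hD1 : (∏ R ∈ D \ {φ A B, φ B C, φ C A}, g A B C R) *
      (∏ R ∈ D \ {φ A B, φ B C, φ C A}, g B C A R) *
      (∏ R ∈ D \ {φ A B, φ B C, φ C A}, g C A B R) = 1 := by
    rw [← Finset.prod_mul_distrib, ← Finset.prod_mul_distrib]
    refine Finset.prod_eq_one fun R hR => ?_
    simp only [Finset.mem_sdiff, Finset.mem_insert, Finset.mem_singleton, not_or] at hR
    obtain ⟨hR, h1, h2, h3⟩ := hR
    exact ceva R (hside A hA B hB hAB R hR h1) (hside B hB C hC hBC R hR h2)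
      (hside C hC A hA hAC.symm R hR h3)
  rw [hA', hB', hC'] at hK1
  have hfA := hf A hA
  have hfB := hf B hB
  have hfC := hf C hC
  have hscal : -(f B.rep / f C.rep) * -(f C.rep / f A.rep) * -(f A.rep / f B.rep) = -1 := by
    field_simp
  have htwo : (2 : F) = 0 := by
    linear_combination hscal - hK1 +
      (-(f B.rep / f C.rep) * -(f C.rep / f A.rep) * -(f A.rep / f B.rep)) * hD1
  rw [Nat.even_iff, ← FiniteField.even_card_iff_char_two]
  by_contra h
  exact Ring.two_ne_zero h htwo
end

section
/- For every even prime power q = 2^e and every divisor d of e, there exists a hyperfocused arc of size 2^d in PG(2,q), and there exists a hyperfocused arc of size 2^d + 2 in PG(2,q). -/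
open scoped LinearAlgebra.Projectivization

variable {F : Type*} [Field F]

open Matrix in
lemma isLine_iff_exists_dotProduct {F : Type*} [Field F] {l : Set (PG2 F)} :
    IsLine l ↔ ∃ w : Fin 3 → F, w ≠ 0 ∧
      ∀ (v : Fin 3 → F) (hv : v ≠ 0), Projectivization.mk F v hv ∈ l ↔ w ⬝ᵥ v = 0 := by
  constructor
  · rintro ⟨f, hf, rfl⟩
    obtain ⟨w, rfl⟩ := (dotProductEquiv F (Fin 3)).surjective f
    refine ⟨w, by rintro rfl; simp at hf, fun v hv => ?_⟩
    obtain ⟨a, ha⟩ := Projectivization.exists_smul_eq_mk_rep F v hv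
    simp [← ha, Units.smul_def]
  · rintro ⟨w, hw, h⟩
    refine ⟨dotProductEquiv F (Fin 3) w, by simpa using hw, ?_⟩
    ext P
    simpa using h P.rep P.rep_nonzero

open Matrix in
lemma mk_cross_eq_of_dotProduct_eq_zero {F : Type*} [Field F] {a b w : Fin 3 → F}
    (hab : a ⨯₃ b ≠ 0) (hw : w ≠ 0) (ha : w ⬝ᵥ a = 0) (hb : w ⬝ᵥ b = 0) :
    Projectivization.mk F (a ⨯₃ b) hab = Projectivization.mk F w hw := by
  rw [Projectivization.mk_eq_mk_iff_crossProduct_eq_zero, cross_cross_eq_smul_sub_smul,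
    dotProduct_comm a, dotProduct_comm b, ha, hb]
  simp

open Matrix in
lemma dotProduct_eq_zero_iff_of_mk_eq {F : Type*} [Field F] {a b : Fin 3 → F}
    {ha : a ≠ 0} {hb : b ≠ 0} (h : Projectivization.mk F a ha = Projectivization.mk F b hb)
    (v : Fin 3 → F) : a ⬝ᵥ v = 0 ↔ b ⬝ᵥ v = 0 := by
  obtain ⟨c, rfl⟩ := (Projectivization.mk_eq_mk_iff F a b ha hb).1 h
  simp [Units.smul_def]

open Matrix in
/-- A criterion for a family of coordinate vectors `p` to give an arc which is hyperfocused on the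
line with coefficient vector `n`, the focus points being given by the family `r`. -/
lemma exists_isArc_hyperfocused_of_vectors {F ι κ : Type*} [Field F] [Finite ι]
    (p : ι → Fin 3 → F) (n : Fin 3 → F) (r : κ → Fin 3 → F)
    (hcross : ∀ i j, i ≠ j → p i ⨯₃ p j ≠ 0)
    (htri : ∀ i j k, i ≠ j → i ≠ k → j ≠ k → p i ⨯₃ p j ⬝ᵥ p k ≠ 0)
    (hn : ∀ i, n ⬝ᵥ p i ≠ 0) (hn0 : n ≠ 0)
    (hr0 : ∀ k, r k ≠ 0) (hrcross : ∀ i j, i ≠ j → r i ⨯₃ r j ≠ 0)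
    (hnr : ∀ k, n ⬝ᵥ r k = 0)
    (hfocus : ∀ k, ∃ i j, i ≠ j ∧ p i ⨯₃ p j ⬝ᵥ r k = 0)
    (hsecant : ∀ i j, i ≠ j → ∃ k, p i ⨯₃ p j ⬝ᵥ r k = 0)
    (hcard : Nat.card κ + 1 = Nat.card ι) :
    ∃ K l : Set (PG2 F), IsArc K ∧ K.ncard = Nat.card ι ∧ Hyperfocused K l := by
  have hp0 : ∀ i, p i ≠ 0 := fun i h => hn i (by simp [h])
  set P : ι → PG2 F := fun i => Projectivization.mk F (p i) (hp0 i) with hP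
  set R : κ → PG2 F := fun k => Projectivization.mk F (r k) (hr0 k) with hR
  have hPinj : Function.Injective P := fun i j h => by
    by_contra hij
    exact hcross i j hij ((Projectivization.mk_eq_mk_iff_crossProduct_eq_zero _ _).1 h)
  have hRinj : Function.Injective R := fun i j h => by
    by_contra hij
    exact hrcross i j hij ((Projectivization.mk_eq_mk_iff_crossProduct_eq_zero _ _).1 h)
  have hfin : (Set.range P).Finite := Set.finite_range P
  have hK : (Set.range P).ncard = Nat.card ι := by
    rw [← Set.image_univ, Set.ncard_image_of_injective _ hPinj, Set.ncard_univ]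
  set l : Set (PG2 F) := {Q | dotProductEquiv F (Fin 3) n Q.rep = 0} with hl
  have hlline : IsLine l := ⟨_, by simpa using hn0, rfl⟩
  have hlmem : ∀ (v : Fin 3 → F) (hv : v ≠ 0),
      Projectivization.mk F v hv ∈ l ↔ n ⬝ᵥ v = 0 := by
    intro v hv
    obtain ⟨a, ha⟩ := Projectivization.exists_smul_eq_mk_rep F v hv
    simp [hl, ← ha, Units.smul_def]
  refine ⟨Set.range P, l, ?_, hK, hlline, ?_, ?_⟩
  · intro m hm
    obtain ⟨w, hw, hwm⟩ := isLine_iff_exists_dotProduct.1 hm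
    by_contra! hlt
    obtain ⟨_, _, _, ⟨⟨i, rfl⟩, hi⟩, ⟨⟨j, rfl⟩, hj⟩, ⟨⟨k, rfl⟩, hk⟩, hij, hik, hjk⟩ :=
      (Set.two_lt_ncard_iff (hfin.inter_of_left m)).1 hlt
    rw [hwm] at hi hj hk
    have hij' : i ≠ j := fun h => hij (congrArg P h)
    exact htri i j k hij' (fun h => hik (congrArg P h)) (fun h => hjk (congrArg P h))
      ((dotProduct_eq_zero_iff_of_mk_eq
        (mk_cross_eq_of_dotProduct_eq_zero (hcross i j hij') hw hi hj) _).2 hk)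
  · ext Q
    simp only [Set.mem_inter_iff, Set.mem_range, Set.mem_empty_iff_false, iff_false, not_and]
    rintro ⟨i, rfl⟩
    rw [hlmem]
    exact hn i
  · suffices h : FocusSet (Set.range P) l = Set.range R by
      rw [h, hK, ← Set.image_univ, Set.ncard_image_of_injective _ hRinj, Set.ncard_univ]
      omega
    ext Q
    constructor
    · rintro ⟨hQl, m, ⟨hm, hm2⟩, hQm⟩
      obtain ⟨w, hw, hwm⟩ := isLine_iff_exists_dotProduct.1 hm
      obtain ⟨_, _, ⟨⟨i, rfl⟩, hi⟩, ⟨⟨j, rfl⟩, hj⟩, hij⟩ :=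
        (Set.one_lt_ncard_iff (hfin.inter_of_left m)).1 hm2
      rw [hwm] at hi hj
      have hij' : i ≠ j := fun h => hij (congrArg P h)
      have hmk := mk_cross_eq_of_dotProduct_eq_zero (hcross i j hij') hw hi hj
      obtain ⟨k, hk⟩ := hsecant i j hij'
      refine ⟨k, ?_⟩
      rw [← Q.mk_rep] at hQl hQm ⊢
      rw [hlmem] at hQl
      rw [hwm, ← dotProduct_eq_zero_iff_of_mk_eq hmk] at hQm
      have hnm : n ⨯₃ (p i ⨯₃ p j) ≠ 0 := fun h => hn i <| by
        rw [dotProduct_eq_zero_iff_of_mk_eq (hb := hcross i j hij')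
          ((Projectivization.mk_eq_mk_iff_crossProduct_eq_zero hn0 _).2 h), dotProduct_comm]
        exact dot_self_cross _ _
      rw [hR, ← mk_cross_eq_of_dotProduct_eq_zero hnm Q.rep_nonzero
        (by rwa [dotProduct_comm]) (by rwa [dotProduct_comm])]
      exact (mk_cross_eq_of_dotProduct_eq_zero hnm (hr0 k)
        (by rw [dotProduct_comm]; exact hnr k) (by rwa [dotProduct_comm])).symm
    · rintro ⟨k, rfl⟩
      refine ⟨(hlmem _ _).2 (hnr k), ?_⟩
      obtain ⟨i, j, hij, hk⟩ := hfocus k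
      obtain ⟨m, hm⟩ : ∃ m : Set (PG2 F), ∀ (v : Fin 3 → F) (hv : v ≠ 0),
          Projectivization.mk F v hv ∈ m ↔ p i ⨯₃ p j ⬝ᵥ v = 0 :=
        ⟨{Q | p i ⨯₃ p j ⬝ᵥ Q.rep = 0}, fun v hv => by
          obtain ⟨a, ha⟩ := Projectivization.exists_smul_eq_mk_rep F v hv
          simp [← ha, Units.smul_def]⟩
      refine ⟨m, ⟨isLine_iff_exists_dotProduct.2 ⟨_, hcross i j hij, hm⟩, ?_⟩, (hm _ _).2 hk⟩
      refine (Set.one_lt_ncard_iff (hfin.inter_of_left m)).2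
        ⟨P i, P j, ⟨⟨i, rfl⟩, (hm _ _).2 ?_⟩, ⟨⟨j, rfl⟩, (hm _ _).2 ?_⟩, hPinj.ne hij⟩
      · rw [dotProduct_comm]; exact dot_self_cross _ _
      · rw [dotProduct_comm]; exact dot_cross_self _ _

open Matrix in
/-- The criterion `exists_isArc_hyperfocused_of_vectors` may be checked over a subfield. -/
lemma exists_isArc_hyperfocused_of_subfield_vectors {E F ι κ : Type*} [Field E] [Field F]
    (φ : E →+* F) [Finite ι] [Nonempty ι]
    (p : ι → Fin 3 → E) (n : Fin 3 → E) (r : κ → Fin 3 → E)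
    (hcross : ∀ i j, i ≠ j → p i ⨯₃ p j ≠ 0)
    (htri : ∀ i j k, i ≠ j → i ≠ k → j ≠ k → p i ⨯₃ p j ⬝ᵥ p k ≠ 0)
    (hn : ∀ i, n ⬝ᵥ p i ≠ 0)
    (hr0 : ∀ k, r k ≠ 0) (hrcross : ∀ i j, i ≠ j → r i ⨯₃ r j ≠ 0)
    (hnr : ∀ k, n ⬝ᵥ r k = 0)
    (hfocus : ∀ k, ∃ i j, i ≠ j ∧ p i ⨯₃ p j ⬝ᵥ r k = 0)
    (hsecant : ∀ i j, i ≠ j → ∃ k, p i ⨯₃ p j ⬝ᵥ r k = 0)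
    (hcard : Nat.card κ + 1 = Nat.card ι) :
    ∃ K l : Set (PG2 F), IsArc K ∧ K.ncard = Nat.card ι ∧ Hyperfocused K l := by
  have hφ0 : ∀ v : Fin 3 → E, φ ∘ v = 0 ↔ v = 0 := fun v => by
    simp [funext_iff]
  have hφc : ∀ v w : Fin 3 → E, (φ ∘ v) ⨯₃ (φ ∘ w) = φ ∘ (v ⨯₃ w) := fun v w => by
    ext i
    fin_cases i <;> simp [cross_apply]
  have hφd : ∀ v w : Fin 3 → E, (φ ∘ v) ⬝ᵥ (φ ∘ w) = φ (v ⬝ᵥ w) := fun v w =>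
    (φ.map_dotProduct v w).symm
  have hn0 : n ≠ 0 := by
    rintro rfl
    exact hn (Classical.arbitrary ι) (by simp)
  refine exists_isArc_hyperfocused_of_vectors (fun i => φ ∘ p i) (φ ∘ n) (fun k => φ ∘ r k)
    ?_ ?_ ?_ ?_ ?_ ?_ ?_ ?_ ?_ hcard <;>
  simpa only [hφc, hφd, hφ0, ne_eq, map_eq_zero]

/-- The finite field of order `2 ^ d` embeds into one of order `2 ^ e` when `d ∣ e`. -/
lemma exists_ringHom_of_card_eq_two_pow {F : Type*} [Field F] [Fintype F] {e d : ℕ}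
    (he : Fintype.card F = 2 ^ e) (hd : d ∣ e) :
    Nat.card (GaloisField 2 d) = 2 ^ d ∧ Nonempty (GaloisField 2 d →+* F) := by
  have he0 : e ≠ 0 := by
    rintro rfl
    exact absurd he (by simpa using (Fintype.one_lt_card (α := F)).ne')
  have hd0 : d ≠ 0 := fun h => he0 (by simpa [h] using hd)
  have : CharP F 2 := charP_of_card_eq_prime_pow he
  let := ZMod.algebra F 2
  have hF : Module.finrank (ZMod 2) F = e := by
    have h := Module.card_eq_pow_finrank (K := ZMod 2) (V := F)
    rw [he, ZMod.card] at h
    exact (Nat.pow_right_injective le_rfl h).symm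
  have hdvd : Module.finrank (ZMod 2) (GaloisField 2 d) ∣ Module.finrank (ZMod 2) F := by
    rw [GaloisField.finrank 2 hd0, hF]
    exact hd
  obtain ⟨f⟩ := FiniteField.nonempty_algHom_of_finrank_dvd hdvd
  exact ⟨GaloisField.card 2 d hd0, ⟨f.toRingHom⟩⟩

lemma exists_forall_mul_add_self_ne {E : Type*} [Field E] [Finite E] [CharP E 2] :
    ∃ a : E, ∀ t : E, t * t + t ≠ a := by
  by_contra! h
  have hinj : Function.Injective fun t : E => t * t + t :=
    Finite.injective_iff_surjective.2 h
  exact zero_ne_one (hinj (a₁ := (0 : E)) (a₂ := 1) (by simp [CharTwo.add_self_eq_zero]))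

open Matrix in
/-- The affine conic `Y = X²` over a subfield of characteristic two. -/
lemma exists_hyperfocused_arc_card_subfield {E F : Type*} [Field E] [Field F] [Finite E]
    [CharP E 2] (φ : E →+* F) :
    ∃ K l : Set (PG2 F), IsArc K ∧ K.ncard = Nat.card E ∧ Hyperfocused K l := by
  refine exists_isArc_hyperfocused_of_subfield_vectors (ι := E) (κ := {g : E // g ≠ 0}) φ
    (fun t => ![t, t ^ 2, 1]) ![0, 0, 1] (fun g => ![1, g, 0]) ?_ ?_ ?_ ?_ ?_ ?_ ?_ ?_ ?_
  · intro i j hij h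
    have := congrFun h 1
    simp [cross_apply] at this
    grind
  · intro i j k hij hik hjk h
    simp [cross_apply] at h
    have : (i - j) * (i - k) * (j - k) = 0 := by linear_combination -h
    grind
  · simp
  · intro k h
    simpa using congrFun h 0
  · intro i j hij h
    have := congrFun h 2
    simp [cross_apply, sub_eq_zero] at this
    exact hij (Subtype.ext this.symm)
  · simp
  · intro k
    refine ⟨0, k, k.2.symm, ?_⟩
    simp [cross_apply]
    ring
  · intro i j hij
    refine ⟨⟨i + j, fun h => hij (CharTwo.add_eq_zero.1 h)⟩, ?_⟩
    simp [cross_apply]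
    ring
  · have := Fintype.ofFinite E
    classical
    rw [Nat.card_eq_fintype_card, Nat.card_eq_fintype_card, Fintype.card_subtype_compl,
      Fintype.card_subtype_eq]
    exact Nat.sub_add_cancel Fintype.card_pos

/-- Coordinate vectors of the regular hyperoval: the conic `Y² = XZ` and its nucleus. -/
def regularHyperovalVec {E : Type*} [Field E] : Option (Option E) → Fin 3 → E
  | none => ![0, 0, 1]
  | some none => ![0, 1, 0]
  | some (some t) => ![1, t, t ^ 2]

/-- Coordinate vectors of the points of the line `aX + Y + Z = 0` in characteristic two. -/
def lineVec {E : Type*} [Field E] (a : E) : Option E → Fin 3 → E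
  | none => ![0, 1, 1]
  | some t => ![1, t, t + a]

open Matrix in
/-- The regular hyperoval over a subfield of characteristic two. -/
lemma exists_hyperfocused_arc_card_subfield_add_two {E F : Type*} [Field E] [Field F] [Finite E]
    [CharP E 2] (φ : E →+* F) :
    ∃ K l : Set (PG2 F), IsArc K ∧ K.ncard = Nat.card E + 2 ∧ Hyperfocused K l := by
  have h2 : (2 : E) = 0 := CharTwo.two_eq_zero
  obtain ⟨a, ha⟩ := exists_forall_mul_add_self_ne (E := E)
  have hcard : Nat.card (Option (Option E)) = Nat.card E + 2 := by
    rw [Finite.card_option, Finite.card_option]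
  rw [← hcard]
  refine exists_isArc_hyperfocused_of_subfield_vectors φ
    regularHyperovalVec ![a, 1, 1] (lineVec a) ?_ ?_ ?_ ?_ ?_ ?_ ?_ ?_ ?_
  · rintro (_ | _ | i) (_ | _ | j) hij h <;>
    have h0 := congrFun h 0 <;> have h1 := congrFun h 1 <;> have h2 := congrFun h 2 <;>
    simp [cross_apply, regularHyperovalVec] at h0 h1 h2 hij
    grind
  · rintro (_ | _ | i) (_ | _ | j) (_ | _ | k) hij hik hjk h <;>
    simp [cross_apply, regularHyperovalVec] at h hij hik hjk <;> grind
  · rintro (_ | _ | i) h <;> simp [regularHyperovalVec] at h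
    exact ha i (by linear_combination h - a * h2)
  · rintro (_ | k) h
    · simpa [lineVec] using congrFun h 1
    · simpa [lineVec] using congrFun h 0
  · rintro (_ | i) (_ | j) hij h <;>
    have h0 := congrFun h 0 <;> have h1 := congrFun h 1 <;> have h2 := congrFun h 2 <;>
    simp [cross_apply, lineVec] at h0 h1 h2 hij
    grind
  · rintro (_ | k) <;> simp [lineVec] <;> grind
  · rintro (_ | k)
    · exact ⟨none, some none, by simp,
        by simp [cross_apply, regularHyperovalVec, lineVec]⟩
    · exact ⟨none, some (some k), by simp,
        by simp [cross_apply, regularHyperovalVec, lineVec]⟩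
  · have hnone : ∀ i, ∃ k, regularHyperovalVec none ⨯₃ regularHyperovalVec (some i) ⬝ᵥ
        lineVec a k = 0 := by
      intro i
      refine ⟨i, ?_⟩
      cases i <;> simp [cross_apply, regularHyperovalVec, lineVec]
    have hnucleus : ∀ t, ∃ k, regularHyperovalVec (some none) ⨯₃
        regularHyperovalVec (some (some t)) ⬝ᵥ lineVec a k = 0 := by
      intro t
      refine ⟨some (t ^ 2 + a), ?_⟩
      simp [cross_apply, regularHyperovalVec, lineVec]
      grind
    have hsymm : ∀ i j : Option (Option E),
        (∃ k, regularHyperovalVec i ⨯₃ regularHyperovalVec j ⬝ᵥ lineVec a k = 0) →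
        ∃ k, regularHyperovalVec j ⨯₃ regularHyperovalVec i ⬝ᵥ lineVec a k = 0 := by
      rintro i j ⟨k, hk⟩
      exact ⟨k, by rw [← cross_anticomm, neg_dotProduct, hk, neg_zero]⟩
    rintro (_ | _ | i) (_ | _ | j) hij
    · exact absurd rfl hij
    · exact hnone _
    · exact hnone _
    · exact hsymm _ _ (hnone _)
    · exact absurd rfl hij
    · exact hnucleus _
    · exact hsymm _ _ (hnone _)
    · exact hsymm _ _ (hnucleus _)
    · have hij' : i ≠ j := fun h => hij (by rw [h])
      by_cases hs : i + j + 1 = 0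
      · refine ⟨none, ?_⟩
        simp [cross_apply, regularHyperovalVec, lineVec]
        grind
      · refine ⟨some ((a + i * j) / (i + j + 1)), ?_⟩
        simp [cross_apply, regularHyperovalVec, lineVec]
        field_simp
        grind
  · rw [hcard, Finite.card_option]

/-- Holder: for `q = 2^e` and every divisor `d` of `e`, there are
hyperfocused arcs of size `2^d` and of size `2^d + 2` in `PG(2,q)`. -/
theorem exists_hyperfocused_arcs_of_size_pow_and_pow_add_two
    (F : Type*) [Field F] [Fintype F] (e d : ℕ)
    (he : Fintype.card F = 2 ^ e) (hd : d ∣ e) :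
    (∃ (K l : Set (PG2 F)), IsArc K ∧ K.ncard = 2 ^ d ∧ Hyperfocused K l) ∧
    (∃ (K l : Set (PG2 F)), IsArc K ∧ K.ncard = 2 ^ d + 2 ∧ Hyperfocused K l) := by
  obtain ⟨hcard, ⟨φ⟩⟩ := exists_ringHom_of_card_eq_two_pow he hd
  have : Finite (GaloisField 2 d) := Nat.finite_of_card_ne_zero (by rw [hcard]; positivity)
  rw [← hcard]
  exact ⟨exists_hyperfocused_arc_card_subfield φ, exists_hyperfocused_arc_card_subfield_add_two φ⟩
end

section
/- Let K be a set of points with |K| > 3 contained in a conic of PG(2,q). Then K is hyperfocused on a tangent line to that conic if and only if q is even and K is projectively equivalent to the set {(t, t², 1) : t ∈ H} for some additive subgroup H of (F_q, +). In particular, in that case |K| divides q. -/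
open scoped LinearAlgebra.Projectivization

variable {F : Type*} [Field F]

open MvPolynomial in
/-- Every ternary quadratic form is a combination of the six quadratic monomials. -/
lemma exists_coeff_of_isHomogeneous_two {Q : MvPolynomial (Fin 3) F} (hQ : Q.IsHomogeneous 2) :
    ∃ a b c d e f : F, Q = C a * X 0 ^ 2 + C b * X 1 ^ 2 + C c * X 2 ^ 2 +
      C d * (X 0 * X 1) + C e * (X 0 * X 2) + C f * (X 1 * X 2) := by
  suffices h : ∀ s : Finset (Fin 3 →₀ ℕ), (∀ m ∈ s, m 0 + m 1 + m 2 = 2) →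
      ∃ a b c d e f : F, ∑ m ∈ s, monomial m (Q.coeff m) =
        C a * X 0 ^ 2 + C b * X 1 ^ 2 + C c * X 2 ^ 2 +
        C d * (X 0 * X 1) + C e * (X 0 * X 2) + C f * (X 1 * X 2) by
    obtain ⟨a, b, c, d, e, f, h⟩ := h Q.support fun m hm => by
      have := hQ (mem_support_iff.1 hm)
      rwa [Finsupp.weight_apply, Finsupp.sum_fintype _ _ (by simp), Fin.sum_univ_three,
        Pi.one_apply, Pi.one_apply, Pi.one_apply, smul_eq_mul, smul_eq_mul, smul_eq_mul,
        mul_one, mul_one, mul_one] at this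
    exact ⟨a, b, c, d, e, f, by rw [← h, support_sum_monomial_coeff]⟩
  intro s
  induction s using Finset.induction_on with
  | empty => exact fun _ => ⟨0, 0, 0, 0, 0, 0, by simp⟩
  | insert m s hms ih =>
    intro hs
    obtain ⟨a, b, c, d, e, f, h⟩ := ih fun n hn => hs n (Finset.mem_insert_of_mem hn)
    have hm := hs m (Finset.mem_insert_self m s)
    rw [Finset.sum_insert hms, h, monomial_eq, Finsupp.prod_fintype _ _ (by simp),
      Fin.prod_univ_three]
    generalize Q.coeff m = k
    obtain ⟨h0, h1, h2⟩ | ⟨h0, h1, h2⟩ | ⟨h0, h1, h2⟩ | ⟨h0, h1, h2⟩ | ⟨h0, h1, h2⟩ |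
        ⟨h0, h1, h2⟩ : (m 0 = 2 ∧ m 1 = 0 ∧ m 2 = 0) ∨ (m 0 = 0 ∧ m 1 = 2 ∧ m 2 = 0) ∨
        (m 0 = 0 ∧ m 1 = 0 ∧ m 2 = 2) ∨ (m 0 = 1 ∧ m 1 = 1 ∧ m 2 = 0) ∨
        (m 0 = 1 ∧ m 1 = 0 ∧ m 2 = 1) ∨ (m 0 = 0 ∧ m 1 = 1 ∧ m 2 = 1) := by omega
    · exact ⟨a + k, b, c, d, e, f, by rw [h0, h1, h2, C_add]; ring⟩
    · exact ⟨a, b + k, c, d, e, f, by rw [h0, h1, h2, C_add]; ring⟩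
    · exact ⟨a, b, c + k, d, e, f, by rw [h0, h1, h2, C_add]; ring⟩
    · exact ⟨a, b, c, d + k, e, f, by rw [h0, h1, h2, C_add]; ring⟩
    · exact ⟨a, b, c, d, e + k, f, by rw [h0, h1, h2, C_add]; ring⟩
    · exact ⟨a, b, c, d, e, f + k, by rw [h0, h1, h2, C_add]; ring⟩

/-- A function on `F³` given by a ternary quadratic form. -/
def IsQuadFun (q : (Fin 3 → F) → F) : Prop :=
  ∃ a b c d e f : F, ∀ v, q v = a * v 0 ^ 2 + b * v 1 ^ 2 + c * v 2 ^ 2 +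
    d * (v 0 * v 1) + e * (v 0 * v 2) + f * (v 1 * v 2)

lemma IsQuadFun.of_isHomogeneous {Q : MvPolynomial (Fin 3) F} (hQ : Q.IsHomogeneous 2) :
    IsQuadFun fun v => MvPolynomial.eval v Q := by
  obtain ⟨a, b, c, d, e, f, rfl⟩ := exists_coeff_of_isHomogeneous_two hQ
  exact ⟨a, b, c, d, e, f, fun v => by simp⟩

lemma IsQuadFun.smul {q : (Fin 3 → F) → F} (hq : IsQuadFun q) (k : F) (v : Fin 3 → F) :
    q (k • v) = k ^ 2 * q v := by
  obtain ⟨a, b, c, d, e, f, h⟩ := hq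
  simp only [h, Pi.smul_apply, smul_eq_mul]
  ring

lemma linearMap_apply_fin_three {M : Type*} [AddCommGroup M] [Module F M]
    (f : (Fin 3 → F) →ₗ[F] M) (v : Fin 3 → F) :
    f v = v 0 • f ![1, 0, 0] + v 1 • f ![0, 1, 0] + v 2 • f ![0, 0, 1] := by
  rw [← map_smul, ← map_smul, ← map_smul, ← map_add, ← map_add]
  congr 1
  funext i
  fin_cases i <;> simp

lemma IsQuadFun.comp {q : (Fin 3 → F) → F} (hq : IsQuadFun q)
    (g : (Fin 3 → F) →ₗ[F] (Fin 3 → F)) : IsQuadFun fun v => q (g v) := by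
  obtain ⟨a, b, c, d, e, f, h⟩ := hq
  set x := g ![1, 0, 0] with hx
  set y := g ![0, 1, 0] with hy
  set z := g ![0, 0, 1] with hz
  refine ⟨q x, q y, q z, q (x + y) - q x - q y, q (x + z) - q x - q z, q (y + z) - q y - q z,
    fun v => ?_⟩
  simp only [linearMap_apply_fin_three g v, ← hx, ← hy, ← hz, h, Pi.add_apply, Pi.smul_apply,
    smul_eq_mul]
  ring

open MvPolynomial in
/-- An irreducible ternary quadratic form is not a product of two linear forms, even as a
function. -/
lemma Irreducible.eval_ne_mul {Q : MvPolynomial (Fin 3) F} (hirr : Irreducible Q)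
    (hQ : Q.IsHomogeneous 2) (f₁ f₂ : (Fin 3 → F) →ₗ[F] F) :
    ¬ ∀ v, eval v Q = f₁ v * f₂ v := by
  intro h
  obtain ⟨a, b, c, d, e, f, rfl⟩ := exists_coeff_of_isHomogeneous_two hQ
  let L : ((Fin 3 → F) →ₗ[F] F) → MvPolynomial (Fin 3) F := fun φ =>
    C (φ ![1, 0, 0]) * X 0 + C (φ ![0, 1, 0]) * X 1 + C (φ ![0, 0, 1]) * X 2
  have hL : ∀ φ, ¬ IsUnit (L φ) := fun φ hu => by
    simpa [L] using hu.map (constantCoeff (R := F) (σ := Fin 3))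
  have hv : ∀ v : Fin 3 → F, a * v 0 ^ 2 + b * v 1 ^ 2 + c * v 2 ^ 2 + d * (v 0 * v 1) +
      e * (v 0 * v 2) + f * (v 1 * v 2) =
      (v 0 * f₁ ![1, 0, 0] + v 1 * f₁ ![0, 1, 0] + v 2 * f₁ ![0, 0, 1]) *
        (v 0 * f₂ ![1, 0, 0] + v 1 * f₂ ![0, 1, 0] + v 2 * f₂ ![0, 0, 1]) := fun v => by
    have := h v
    rw [linearMap_apply_fin_three f₁ v, linearMap_apply_fin_three f₂ v] at this
    simpa using this
  have ha := hv ![1, 0, 0]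
  have hb := hv ![0, 1, 0]
  have hc := hv ![0, 0, 1]
  have hd := hv ![1, 1, 0]
  have he := hv ![1, 0, 1]
  have hf := hv ![0, 1, 1]
  simp at ha hb hc hd he hf
  have hd' : d = f₁ ![1, 0, 0] * f₂ ![0, 1, 0] + f₁ ![0, 1, 0] * f₂ ![1, 0, 0] := by
    linear_combination hd - ha - hb
  have he' : e = f₁ ![1, 0, 0] * f₂ ![0, 0, 1] + f₁ ![0, 0, 1] * f₂ ![1, 0, 0] := by
    linear_combination he - ha - hc
  have hf' : f = f₁ ![0, 1, 0] * f₂ ![0, 0, 1] + f₁ ![0, 0, 1] * f₂ ![0, 1, 0] := by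
    linear_combination hf - hb - hc
  refine (hirr.isUnit_or_isUnit (a := L f₁) (b := L f₂) ?_).elim (hL f₁) (hL f₂)
  rw [ha, hb, hc, hd', he', hf']
  simp only [L, C_add, C_mul]
  ring

/-- If the sums of two distinct elements of `S` take at most `|S| - 1` values, then the
characteristic is two and `S` is a coset of an additive subgroup. -/
lemma exists_addSubgroup_of_ncard_sums {S T : Set F} [Finite F] (hS : 2 < S.ncard)
    (hT : T.ncard ≤ S.ncard - 1) (hST : ∀ s ∈ S, ∀ t ∈ S, s ≠ t → s + t ∈ T) :
    (2 : F) = 0 ∧ ∃ (u : F) (H : AddSubgroup F), ∀ t, t ∈ S ↔ t + u ∈ H := by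
  have key : ∀ x ∈ S, ∀ τ ∈ T, τ - x ∈ S ∧ τ - x ≠ x := by
    intro x hx τ hτ
    have hsub : (fun s => x + s) '' (S \ {x}) ⊆ T := by
      rintro _ ⟨s, ⟨hs, hsx⟩, rfl⟩
      exact hST x hx s hs (Ne.symm hsx)
    have heq := Set.eq_of_subset_of_ncard_le hsub (by
      rw [Set.ncard_image_of_injective _ (add_right_injective x),
        Set.ncard_sdiff_singleton_of_mem hx]
      exact hT) (Set.toFinite _)
    rw [← heq] at hτ
    obtain ⟨s, ⟨hs, hsx⟩, rfl⟩ := hτ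
    simpa using ⟨hs, hsx⟩
  obtain ⟨u, hu, x, hx, y, hy, hux, huy, hxy⟩ := (Set.two_lt_ncard (Set.toFinite S)).1 hS
  have h2 : (2 : F) = 0 := by
    have h1 := (key x hx _ (hST u hu y hy huy)).1
    have h1' := (key y hy _ (hST u hu x hx hux)).1
    by_contra h2
    have hne : u + y - x ≠ u + x - y := fun h =>
      hxy (sub_eq_zero.1 ((mul_eq_zero.1 (show 2 * (x - y) = 0 by
        linear_combination -h)).resolve_left h2))
    refine (key u hu _ (hST _ h1 _ h1' hne)).2 ?_
    ring
  let H : AddSubgroup F :=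
    { carrier := {w | w + u ∈ S}
      zero_mem' := by simpa using hu
      add_mem' := by
        intro h k hh hk
        simp only [Set.mem_ofPred_eq] at hh hk ⊢
        by_cases hhk : h = k
        · rwa [show h + k + u = u by linear_combination h2 * k + hhk]
        · have := (key u hu _ (hST _ hh _ hk (by simpa using hhk))).1
          rwa [show h + u + (k + u) - u = h + k + u by ring] at this
      neg_mem' := by
        intro h hh
        simp only [Set.mem_ofPred_eq] at hh ⊢
        rwa [show -h + u = h + u by linear_combination -h2 * h] }
  refine ⟨h2, u, H, fun t => ?_⟩
  change _ ↔ t + u + u ∈ S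
  rw [show t + u + u = t by linear_combination h2 * u]

lemma linear_rep_mk_eq_zero_iff {M : Type*} [AddCommGroup M] [Module F M]
    (f : (Fin 3 → F) →ₗ[F] M) {v : Fin 3 → F} (hv : v ≠ 0) :
    f (Projectivization.mk F v hv).rep = 0 ↔ f v = 0 := by
  obtain ⟨a, ha⟩ := Projectivization.exists_smul_eq_mk_rep F v hv
  rw [← ha, Units.smul_def, map_smul, smul_eq_zero_iff_right a.ne_zero]

lemma IsQuadFun.rep_mk_eq_zero_iff {q : (Fin 3 → F) → F} (hq : IsQuadFun q)
    {v : Fin 3 → F} (hv : v ≠ 0) :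
    q (Projectivization.mk F v hv).rep = 0 ↔ q v = 0 := by
  obtain ⟨a, ha⟩ := Projectivization.exists_smul_eq_mk_rep F v hv
  rw [← ha, Units.smul_def, hq.smul]
  simp

/-- The point `(t, t², 1)` in the coordinates given by `g`. -/
def parabolaPt (g : (Fin 3 → F) ≃ₗ[F] (Fin 3 → F)) (t : F) : PG2 F :=
  Projectivization.mk F (g ![t, t ^ 2, 1])
    ((map_ne_zero_iff g g.injective).2 (mk3_ne_zero (Or.inr (Or.inr one_ne_zero))))

/-- The point at infinity `(1, m, 0)` in the coordinates given by `g`. -/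
def slopePt (g : (Fin 3 → F) ≃ₗ[F] (Fin 3 → F)) (m : F) : PG2 F :=
  Projectivization.mk F (g ![1, m, 0])
    ((map_ne_zero_iff g g.injective).2 (mk3_ne_zero (Or.inl one_ne_zero)))

/-- The line at infinity in the coordinates given by `g`. -/
def lineAtInfinity (g : (Fin 3 → F) ≃ₗ[F] (Fin 3 → F)) : Set (PG2 F) :=
  {P | g.symm P.rep 2 = 0}

lemma isLine_lineAtInfinity (g : (Fin 3 → F) ≃ₗ[F] (Fin 3 → F)) :
    IsLine (lineAtInfinity g) := by
  refine ⟨LinearMap.proj 2 ∘ₗ g.symm.toLinearMap, fun h => ?_, rfl⟩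
  simpa using LinearMap.congr_fun h (g ![0, 0, 1])

lemma mk_mem_lineAtInfinity (g : (Fin 3 → F) ≃ₗ[F] (Fin 3 → F)) {v : Fin 3 → F} (hv : v ≠ 0) :
    Projectivization.mk F v hv ∈ lineAtInfinity g ↔ g.symm v 2 = 0 :=
  linear_rep_mk_eq_zero_iff ((LinearMap.proj 2 : (Fin 3 → F) →ₗ[F] F) ∘ₗ g.symm.toLinearMap) hv

lemma parabolaPt_injective (g : (Fin 3 → F) ≃ₗ[F] (Fin 3 → F)) :
    Function.Injective (parabolaPt g) := by
  intro s t h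
  obtain ⟨a, ha⟩ := (Projectivization.mk_eq_mk_iff' F _ _ _ _).1 h
  rw [← map_smul] at ha
  have h' := g.injective ha
  have h0 := congrFun h' 0
  have h2 := congrFun h' 2
  simp at h0 h2
  rw [← h0, h2, one_mul]

lemma slopePt_injective (g : (Fin 3 → F) ≃ₗ[F] (Fin 3 → F)) :
    Function.Injective (slopePt g) := by
  intro s t h
  obtain ⟨a, ha⟩ := (Projectivization.mk_eq_mk_iff' F _ _ _ _).1 h
  rw [← map_smul] at ha
  have h' := g.injective ha
  have h0 := congrFun h' 0
  have h1 := congrFun h' 1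
  simp at h0 h1
  rw [← h1, h0, one_mul]

lemma parabolaPt_notMem_lineAtInfinity (g : (Fin 3 → F) ≃ₗ[F] (Fin 3 → F)) (t : F) :
    parabolaPt g t ∉ lineAtInfinity g := by
  simp [parabolaPt, mk_mem_lineAtInfinity]

/-- The secants of a subset of a parabola meet the line at infinity in the points whose slopes
are the sums of two distinct parameters. -/
lemma focusSet_image_parabolaPt [Finite F] (g : (Fin 3 → F) ≃ₗ[F] (Fin 3 → F)) (S : Set F) :
    FocusSet (parabolaPt g '' S) (lineAtInfinity g) =
      slopePt g '' {m | ∃ s ∈ S, ∃ t ∈ S, s ≠ t ∧ s + t = m} := by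
  ext P
  constructor
  · rintro ⟨hPl, m, ⟨⟨f, hf, rfl⟩, hcard⟩, hPm⟩
    obtain ⟨_, ⟨⟨s, hs, rfl⟩, hsm⟩, _, ⟨⟨t, ht, rfl⟩, htm⟩, hst⟩ :=
      (Set.one_lt_ncard (Set.toFinite _)).1 hcard
    have hst' : s ≠ t := fun h => hst (by rw [h])
    refine ⟨s + t, ⟨s, hs, t, ht, hst', rfl⟩, ?_⟩
    replace hsm := (linear_rep_mk_eq_zero_iff f _).1 hsm
    replace htm := (linear_rep_mk_eq_zero_iff f _).1 htm
    have hP0 : g.symm P.rep ≠ 0 := (map_ne_zero_iff g.symm g.symm.injective).2 P.rep_nonzero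
    obtain ⟨w, hw⟩ : ∃ w, w = g.symm P.rep := ⟨_, rfl⟩
    have hPw : P.rep = g w := by simp [hw]
    have hw2 : w 2 = 0 := by rw [hw]; exact hPl
    rw [← hw] at hP0
    replace hPm : f P.rep = 0 := hPm
    rw [hPw] at hPm
    have hfg : ∀ v, f (g v) = v 0 • f (g ![1, 0, 0]) + v 1 • f (g ![0, 1, 0]) +
        v 2 • f (g ![0, 0, 1]) := linearMap_apply_fin_three (f ∘ₗ g.toLinearMap)
    rw [hfg] at hsm htm hPm
    simp [hw2] at hsm htm hPm
    generalize hA : f (g ![1, 0, 0]) = A at *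
    generalize hB : f (g ![0, 1, 0]) = B at *
    generalize hD : f (g ![0, 0, 1]) = D at *
    have hA' : A = -(s + t) * B := by
      refine mul_left_cancel₀ (sub_ne_zero.2 hst') ?_
      linear_combination hsm - htm
    have hB0 : B ≠ 0 := by
      rintro rfl
      have hA0 : A = 0 := by simpa using hA'
      have hD0 : D = 0 := by simpa [hA0] using hsm
      refine hf (LinearMap.ext fun v => ?_)
      have := hfg (g.symm v)
      simpa [hA0, hD0] using this
    have hw1 : w 1 = w 0 * (s + t) := by
      refine mul_left_cancel₀ hB0 ?_
      linear_combination hPm - w 0 * hA'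
    have hww : w = w 0 • ![1, s + t, 0] := by
      funext i
      fin_cases i <;> simp [hw1, hw2]
    rw [← P.mk_rep]
    refine ((Projectivization.mk_eq_mk_iff' F _ _ _ _).2 ⟨w 0, ?_⟩).symm
    rw [← map_smul, ← hww, hPw]
  · rintro ⟨_, ⟨s, hs, t, ht, hst, rfl⟩, rfl⟩
    refine ⟨by simp [slopePt, mk_mem_lineAtInfinity], ?_⟩
    let f : (Fin 3 → F) →ₗ[F] F :=
      ((s + t) • LinearMap.proj 0 - LinearMap.proj 1 - (s * t) • LinearMap.proj 2) ∘ₗ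
        g.symm.toLinearMap
    refine ⟨{P | f P.rep = 0}, ⟨⟨f, fun h => ?_, rfl⟩, ?_⟩, ?_⟩
    · simpa [f] using LinearMap.congr_fun h (g ![0, 1, 0])
    · refine (Set.one_lt_ncard (Set.toFinite _)).2 ⟨parabolaPt g s, ⟨⟨s, hs, rfl⟩, ?_⟩,
        parabolaPt g t, ⟨⟨t, ht, rfl⟩, ?_⟩, (parabolaPt_injective g).ne hst⟩
      · refine (linear_rep_mk_eq_zero_iff f _).2 ?_
        simp [f]
        ring
      · refine (linear_rep_mk_eq_zero_iff f _).2 ?_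
        simp [f]
        ring
    · refine (linear_rep_mk_eq_zero_iff f _).2 ?_
      simp [f]

lemma exists_linearEquiv_of_mem_ker {f : (Fin 3 → F) →ₗ[F] F} (hf : f ≠ 0) {p : Fin 3 → F}
    (hp : p ≠ 0) (hfp : f p = 0) :
    ∃ g : (Fin 3 → F) ≃ₗ[F] (Fin 3 → F), g ![0, 1, 0] = p ∧ ∀ v, f (g v) = v 2 := by
  obtain ⟨w, hw⟩ : ∃ w, f w = 1 := LinearMap.surjective hf 1
  obtain ⟨h, hhp⟩ : ∃ h : (Fin 3 → F) →ₗ[F] F, h p ≠ 0 := by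
    by_contra! hall
    exact hp ((Module.forall_dual_apply_eq_zero_iff F p).1 hall)
  obtain ⟨u, hu, hu0⟩ := (Submodule.ne_bot_iff _).1
    (LinearMap.ker_ne_bot_of_finrank_lt (f := f.prod h) (by simp))
  obtain ⟨hfu, hhu⟩ : f u = 0 ∧ h u = 0 := by simpa using hu
  let L : (Fin 3 → F) →ₗ[F] (Fin 3 → F) := Fintype.linearCombination F ![u, p, w]
  have hL : ∀ v, L v = v 0 • u + v 1 • p + v 2 • w := fun v => by
    simp [L, Fintype.linearCombination_apply, Fin.sum_univ_three]
  have hfL : ∀ v, f (L v) = v 2 := fun v => by simp [hL, hfu, hfp, hw]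
  have hinj : Function.Injective L := by
    refine (injective_iff_map_eq_zero L).2 fun v hv => ?_
    have h2 : v 2 = 0 := by rw [← hfL v, hv, map_zero]
    have h1 : v 1 = 0 := by
      have := congrArg h hv
      simpa [hL, h2, hhu, hhp] using this
    have h0 : v 0 = 0 := by simpa [hL, h1, h2, hu0] using hv
    funext i
    fin_cases i <;> assumption
  exact ⟨LinearEquiv.ofInjectiveEndo L hinj, by simp [hL], hfL⟩

/-- In suitable coordinates a nondegenerate conic touching the line `f = 0` is the parabola
`X₁² = X₂X₃`, and the line is `X₃ = 0`. -/
lemma IsQuadFun.exists_parabola {q : (Fin 3 → F) → F} (hq : IsQuadFun q)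
    (hprod : ∀ f₁ f₂ : (Fin 3 → F) →ₗ[F] F, ¬ ∀ v, q v = f₁ v * f₂ v)
    {f : (Fin 3 → F) →ₗ[F] F} (hf : f ≠ 0) {p : Fin 3 → F} (hp : p ≠ 0) (hfp : f p = 0)
    (hqp : q p = 0) (huniq : ∀ v, f v = 0 → q v = 0 → ∃ k : F, v = k • p)
    {r : Fin 3 → F} (hqr : q r = 0) (hfr : f r ≠ 0) :
    ∃ (g : (Fin 3 → F) ≃ₗ[F] (Fin 3 → F)) (a : F), a ≠ 0 ∧
      (∀ v, q (g v) = a * (v 0 ^ 2 - v 1 * v 2)) ∧ ∀ v, f (g v) = v 2 := by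
  obtain ⟨g, hgp, hfg⟩ := exists_linearEquiv_of_mem_ker hf hp hfp
  obtain ⟨a, b, c, d, e, k, hqg⟩ := hq.comp g.toLinearMap
  simp only [LinearEquiv.coe_coe] at hqg
  have hprod' : ∀ f₁ f₂ : (Fin 3 → F) →ₗ[F] F, ¬ ∀ v, q (g v) = f₁ v * f₂ v := by
    intro f₁ f₂ h
    refine hprod (f₁ ∘ₗ g.symm.toLinearMap) (f₂ ∘ₗ g.symm.toLinearMap) fun v => ?_
    simpa using h (g.symm v)
  have hb : b = 0 := by simpa [hgp, hqp] using (hqg ![0, 1, 0]).symm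
  subst hb
  have hd : d = 0 := by
    obtain ⟨m, hm⟩ := huniq (g ![d, -a, 0]) (by simp [hfg]) (by rw [hqg]; simp; ring)
    rw [← hgp, ← map_smul] at hm
    simpa using congrFun (g.injective hm) 0
  subst hd
  have ha : a ≠ 0 := by
    rintro rfl
    refine hprod' (LinearMap.proj 2)
      (c • LinearMap.proj 2 + e • LinearMap.proj 0 + k • LinearMap.proj 1) fun v => ?_
    rw [hqg]
    simp
    ring
  have hk : k ≠ 0 := by
    rintro rfl
    obtain ⟨w, rfl⟩ := g.surjective r
    rw [hfg] at hfr
    rw [hqg] at hqr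
    refine hprod' (LinearMap.proj 0 - (w 0 / w 2) • LinearMap.proj 2)
      (a • LinearMap.proj 0 + (a * (w 0 / w 2) + e) • LinearMap.proj 2) fun v => ?_
    have hc : c = -(a * (w 0 / w 2) ^ 2 + e * (w 0 / w 2)) := by
      field_simp
      linear_combination hqr
    rw [hqg]
    simp [hc]
    ring
  let s : (Fin 3 → F) ≃ₗ[F] (Fin 3 → F) :=
    { toFun := fun v => ![v 0, -(a * v 1 + e * v 0 + c * v 2) / k, v 2]
      invFun := fun v => ![v 0, -(k * v 1 + e * v 0 + c * v 2) / a, v 2]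
      left_inv := fun v => by
        funext i
        fin_cases i
        · simp
        · simp
          field_simp
          ring
        · simp
      right_inv := fun v => by
        funext i
        fin_cases i
        · simp
        · simp
          field_simp
          ring
        · simp
      map_add' := fun u v => by
        funext i
        fin_cases i
        · simp
        · simp
          field_simp
          ring
        · simp
      map_smul' := fun m v => by
        funext i
        fin_cases i
        · simp
        · simp
          field_simp
        · simp }
  have hs : ∀ v, s v = ![v 0, -(a * v 1 + e * v 0 + c * v 2) / k, v 2] := fun v => rfl
  refine ⟨s.trans g, a, ha, fun v => ?_, fun v => ?_⟩
  · rw [LinearEquiv.trans_apply, hqg, hs]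
    simp
    field_simp
    ring
  · rw [LinearEquiv.trans_apply, hfg, hs]
    simp

lemma eq_parabolaPt (g : (Fin 3 → F) ≃ₗ[F] (Fin 3 → F)) {P : PG2 F}
    (h2 : g.symm P.rep 2 ≠ 0)
    (hP : g.symm P.rep 0 ^ 2 = g.symm P.rep 1 * g.symm P.rep 2) :
    P = parabolaPt g (g.symm P.rep 0 / g.symm P.rep 2) := by
  have hrep : P.rep = g (g.symm P.rep) := by simp
  conv_lhs => rw [← P.mk_rep]
  refine (Projectivization.mk_eq_mk_iff' F _ _ _ _).2 ⟨g.symm P.rep 2, ?_⟩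
  conv_rhs => rw [hrep]
  rw [← map_smul]
  congr 1
  funext i
  fin_cases i
  · simp
    field_simp
  · simp
    field_simp
    linear_combination hP
  · simp

lemma parabolaPt_tEquiv_symm_trans (h2 : (2 : F) = 0) (g : (Fin 3 → F) ≃ₗ[F] (Fin 3 → F))
    (u t : F) : parabolaPt ((tEquiv (u, u ^ 2)).symm.trans g) (t + u) = parabolaPt g t := by
  unfold parabolaPt
  congr 1
  rw [LinearEquiv.trans_apply]
  congr 1
  change ![_, _, _] = _
  funext i
  fin_cases i
  · simp
  · simp
    linear_combination t * u * h2
  · simp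

lemma map_symm_parabolaPt (g : (Fin 3 → F) ≃ₗ[F] (Fin 3 → F)) (t : F) :
    Projectivization.map g.symm.toLinearMap g.symm.injective (parabolaPt g t) =
      pt t (t ^ 2) 1 (mk3_ne_zero (Or.inr (Or.inr one_ne_zero))) := by
  simp [parabolaPt, pt, Projectivization.map_mk]

/-- A subset of a conic which is hyperfocused on a tangent line is, in suitable coordinates,
the set of points `(t, t², 1)` with `t` in an additive subgroup, and the characteristic is
two. -/
lemma exists_parabolaPt_image_of_hyperfocused [Finite F] {C K l : Set (PG2 F)} (hC : IsConic C)
    (hKC : K ⊆ C) (hcard : 2 < K.ncard) (hCl : IsTangentLine C l) (hKl : Hyperfocused K l) :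
    (2 : F) = 0 ∧ ∃ (g : (Fin 3 → F) ≃ₗ[F] (Fin 3 → F)) (H : AddSubgroup F),
      K = parabolaPt g '' H := by
  obtain ⟨Q, hQ, hirr, rfl⟩ := hC
  obtain ⟨⟨f, hf, rfl⟩, htan⟩ := hCl
  obtain ⟨-, hdisj, hfocus⟩ := hKl
  have hq := IsQuadFun.of_isHomogeneous hQ
  obtain ⟨P, hP⟩ := Set.ncard_eq_one.1 htan
  obtain ⟨hPC, hPl⟩ : P ∈ {P : PG2 F | MvPolynomial.eval P.rep Q = 0} ∩
      {P : PG2 F | f P.rep = 0} := hP ▸ rfl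
  obtain ⟨R, hR⟩ : K.Nonempty := Set.nonempty_of_ncard_ne_zero (by omega)
  have hKf : ∀ R ∈ K, f R.rep ≠ 0 := fun R hR h =>
    Set.eq_empty_iff_forall_notMem.1 hdisj R ⟨hR, h⟩
  obtain ⟨g, a, ha, hqg, hfg⟩ := hq.exists_parabola (hirr.eval_ne_mul hQ) hf P.rep_nonzero hPl hPC
    (fun v hfv hqv => by
      by_cases hv : v = 0
      · exact ⟨0, by simp [hv]⟩
      have hmem : Projectivization.mk F v hv ∈ {P : PG2 F | MvPolynomial.eval P.rep Q = 0} ∩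
          {P : PG2 F | f P.rep = 0} :=
        ⟨(hq.rep_mk_eq_zero_iff hv).2 hqv, (linear_rep_mk_eq_zero_iff f hv).2 hfv⟩
      rw [hP, Set.mem_singleton_iff, ← P.mk_rep] at hmem
      obtain ⟨k, hk⟩ := (Projectivization.mk_eq_mk_iff' F _ _ _ _).1 hmem
      exact ⟨k, hk.symm⟩) (hKC hR) (hKf R hR)
  have hl : {P : PG2 F | f P.rep = 0} = lineAtInfinity g := by
    ext P
    change f P.rep = 0 ↔ g.symm P.rep 2 = 0
    rw [← hfg (g.symm P.rep), LinearEquiv.apply_symm_apply]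
  have hK : K = parabolaPt g '' (parabolaPt g ⁻¹' K) := by
    refine (Set.image_preimage_eq_of_subset fun P hPK => ?_).symm
    refine ⟨_, (eq_parabolaPt g ?_ ?_).symm⟩
    · rw [← hfg (g.symm P.rep), LinearEquiv.apply_symm_apply]
      exact hKf P hPK
    · have := hqg (g.symm P.rep)
      rw [LinearEquiv.apply_symm_apply, show MvPolynomial.eval P.rep Q = 0 from hKC hPK] at this
      exact sub_eq_zero.1 ((mul_eq_zero.1 this.symm).resolve_left ha)
  generalize parabolaPt g ⁻¹' K = S at hK
  subst hK
  rw [hl, focusSet_image_parabolaPt, Set.ncard_image_of_injective _ (slopePt_injective g),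
    Set.ncard_image_of_injective _ (parabolaPt_injective g)] at hfocus
  rw [Set.ncard_image_of_injective _ (parabolaPt_injective g)] at hcard
  obtain ⟨h2, u, H, hH⟩ := exists_addSubgroup_of_ncard_sums hcard hfocus.le
    fun s hs t ht hst => ⟨s, hs, t, ht, hst, rfl⟩
  refine ⟨h2, (tEquiv (u, u ^ 2)).symm.trans g, H, ?_⟩
  ext P
  constructor
  · rintro ⟨t, ht, rfl⟩
    exact ⟨t + u, (hH t).1 ht, parabolaPt_tEquiv_symm_trans h2 g u t⟩
  · rintro ⟨t, ht, rfl⟩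
    refine ⟨t - u, (hH _).2 (by simpa using ht), ?_⟩
    rw [← parabolaPt_tEquiv_symm_trans h2, sub_add_cancel]

/-- In characteristic two, the points `(t, t², 1)` with `t` in an additive subgroup form a
hyperfocused set on the line at infinity. -/
lemma hyperfocused_parabolaPt_image [Finite F] (h2 : (2 : F) = 0)
    (g : (Fin 3 → F) ≃ₗ[F] (Fin 3 → F)) (H : AddSubgroup F) :
    Hyperfocused (parabolaPt g '' H) (lineAtInfinity g) := by
  refine ⟨isLine_lineAtInfinity g, Set.eq_empty_iff_forall_notMem.2 ?_, ?_⟩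
  · rintro _ ⟨⟨t, -, rfl⟩, h⟩
    exact parabolaPt_notMem_lineAtInfinity g t h
  · rw [focusSet_image_parabolaPt, Set.ncard_image_of_injective _ (slopePt_injective g),
      Set.ncard_image_of_injective _ (parabolaPt_injective g),
      ← Set.ncard_sdiff_singleton_of_mem (show (0 : F) ∈ (H : Set F) from H.zero_mem)]
    congr 1
    ext m
    constructor
    · rintro ⟨s, hs, t, ht, hst, rfl⟩
      refine ⟨H.add_mem hs ht, fun h => hst ?_⟩
      rw [Set.mem_singleton_iff] at h
      linear_combination h - t * h2
    · rintro ⟨hm, hm0⟩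
      exact ⟨m, hm, 0, H.zero_mem, hm0, add_zero m⟩

/-- In characteristic two, a quartic polynomial vanishing on an additive subgroup of order at least
four has no cubic term. -/
lemma cubic_coeff_eq_zero (h2 : (2 : F) = 0) {H : AddSubgroup F} (hH : 3 < (H : Set F).ncard)
    {b d k e c : F} (h : ∀ t ∈ H, b * t ^ 4 + d * t ^ 3 + k * t ^ 2 + e * t + c = 0) : d = 0 := by
  have hfin : (H : Set F).Finite := Set.finite_of_ncard_pos (by omega)
  have hcard : 1 < ((H : Set F) \ {0}).ncard := by
    rw [Set.ncard_sdiff_singleton_of_mem (show (0 : F) ∈ (H : Set F) from H.zero_mem)]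
    omega
  obtain ⟨u, ⟨hu, hu0⟩, v, ⟨hv, hv0⟩, huv⟩ := (Set.one_lt_ncard hfin.sdiff).1 hcard
  rw [Set.mem_singleton_iff] at hu0 hv0
  have hw0 : u + v ≠ 0 := fun h => huv (by linear_combination h - v * h2)
  have hc : c = 0 := by simpa using h 0 H.zero_mem
  subst hc
  have h' : ∀ t ∈ H, t ≠ 0 → b * t ^ 3 + d * t ^ 2 + k * t + e = 0 := fun t ht ht0 =>
    mul_left_cancel₀ ht0 (by linear_combination h t ht)
  have h1 := h' u hu hu0
  have h3 := h' v hv hv0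
  have h4 := h' _ (H.add_mem hu hv) hw0
  have h5 : b * (u ^ 2 + u * v + v ^ 2) + d * (u + v) + k = 0 :=
    mul_left_cancel₀ (sub_ne_zero.2 huv) (by linear_combination h1 - h3)
  have h6 : b * (3 * u ^ 2 + 3 * u * v + v ^ 2) + d * (2 * u + v) + k = 0 :=
    mul_left_cancel₀ hv0 (by linear_combination h4 - h1)
  refine mul_left_cancel₀ hu0 ?_
  linear_combination h6 - h5 - (b * (u ^ 2 + u * v)) * h2

/-- In characteristic two, a conic through the points `(t, t², 1)` with `t` in an additive
subgroup of order at least four touches the line at infinity. -/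
lemma isTangentLine_lineAtInfinity [Finite F] (h2 : (2 : F) = 0)
    (g : (Fin 3 → F) ≃ₗ[F] (Fin 3 → F)) {H : AddSubgroup F} (hH : 3 < (H : Set F).ncard)
    {C : Set (PG2 F)} (hC : IsConic C) (hHC : parabolaPt g '' H ⊆ C) :
    IsTangentLine C (lineAtInfinity g) := by
  refine ⟨isLine_lineAtInfinity g, ?_⟩
  obtain ⟨Q, hQ, hirr, rfl⟩ := hC
  have hq := IsQuadFun.of_isHomogeneous hQ
  obtain ⟨a, b, c, d, e, f, hqg⟩ := hq.comp g.toLinearMap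
  simp only [LinearEquiv.coe_coe] at hqg
  have hd : d = 0 := cubic_coeff_eq_zero h2 hH (b := b) (k := a + f) (e := e) (c := c)
    fun t ht => by
      have := (hq.rep_mk_eq_zero_iff _).1 (hHC ⟨t, ht, rfl⟩)
      rw [hqg] at this
      simp at this
      linear_combination this
  subst hd
  have : CharP F 2 := CharTwo.of_one_ne_zero_of_two_eq_zero one_ne_zero h2
  obtain ⟨α, rfl⟩ := isSquare_of_charTwo' a
  obtain ⟨β, rfl⟩ := isSquare_of_charTwo' b
  have hαβ : α ≠ 0 ∨ β ≠ 0 := by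
    by_contra! hαβ
    obtain ⟨rfl, rfl⟩ := hαβ
    refine hirr.eval_ne_mul hQ (LinearMap.proj 2 ∘ₗ g.symm.toLinearMap)
      ((c • LinearMap.proj 2 + e • LinearMap.proj 0 + f • LinearMap.proj 1) ∘ₗ
        g.symm.toLinearMap) fun v => ?_
    have := hqg (g.symm v)
    rw [LinearEquiv.apply_symm_apply] at this
    rw [this]
    simp
    ring
  have hN : (![β, α, 0] : Fin 3 → F) ≠ 0 := mk3_ne_zero (by tauto)
  refine Set.ncard_eq_one.2 ⟨Projectivization.mk F (g ![β, α, 0])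
    ((map_ne_zero_iff g g.injective).2 hN), ?_⟩
  ext P
  rw [Set.mem_singleton_iff]
  constructor
  · rintro ⟨hPC, hPl⟩
    obtain ⟨w, hw⟩ := g.surjective P.rep
    have hw2 : w 2 = 0 := by
      rw [← g.symm_apply_apply w, hw]
      exact hPl
    have hsq : (α * w 0 + β * w 1) ^ 2 = 0 := by
      have := hqg w
      rw [hw, show MvPolynomial.eval P.rep Q = 0 from hPC, hw2] at this
      linear_combination -this + α * β * w 0 * w 1 * h2
    have hlin := pow_eq_zero_iff two_ne_zero |>.1 hsq
    rw [← P.mk_rep]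
    refine (Projectivization.mk_eq_mk_iff' F _ _ _ _).2 ?_
    simp only [← hw, ← map_smul]
    suffices h : ∃ k : F, k • ![β, α, 0] = w by
      obtain ⟨k, hk⟩ := h
      exact ⟨k, by rw [hk]⟩
    rcases hαβ with hα | hβ
    · refine ⟨w 1 / α, ?_⟩
      funext i
      fin_cases i
      · simp
        field_simp
        linear_combination hlin - α * w 0 * h2
      · simp
        field_simp
      · simp [hw2]
    · refine ⟨w 0 / β, ?_⟩
      funext i
      fin_cases i
      · simp
        field_simp
      · simp
        field_simp
        linear_combination hlin - β * w 1 * h2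
      · simp [hw2]
  · rintro rfl
    refine ⟨(hq.rep_mk_eq_zero_iff _).2 ?_, (mk_mem_lineAtInfinity g _).2 (by simp)⟩
    rw [hqg]
    simp
    linear_combination α ^ 2 * β ^ 2 * h2

/-- a set `K` of more than 3 points on a conic is hyperfocused on
a tangent line to that conic iff `q` is even and `K` is projectively
equivalent to `{(t, t², 1) : t ∈ H}` for some additive subgroup `H` of `F_q`;
in particular in that case `|K|` divides `q`. -/
theorem hyperfocused_on_tangent_iff_subgroup {F : Type*} [Field F] [Fintype F]
    (C K : Set (PG2 F)) (hC : IsConic C) (hKC : K ⊆ C) (hcard : 3 < K.ncard) :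
    ((∃ l : Set (PG2 F), IsTangentLine C l ∧ Hyperfocused K l) ↔
      (Even (Fintype.card F) ∧
        ∃ (H : AddSubgroup F) (φ : PG2 F → PG2 F), IsProjectivity φ ∧
          φ '' K = {P : PG2 F | ∃ t ∈ H,
            P = pt t (t ^ 2) 1 (mk3_ne_zero (Or.inr (Or.inr one_ne_zero)))})) ∧
    ((∃ l : Set (PG2 F), IsTangentLine C l ∧ Hyperfocused K l) →
      K.ncard ∣ Fintype.card F) := by
  have heven : Even (Fintype.card F) ↔ (2 : F) = 0 := by
    rw [Nat.even_iff, ← FiniteField.even_card_iff_char_two]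
    refine ⟨fun h => ?_, fun h => ?_⟩
    · have := ringChar.of_eq h
      exact CharTwo.two_eq_zero
    · have := CharTwo.of_one_ne_zero_of_two_eq_zero one_ne_zero h
      exact (ringChar.eq_iff).2 this
  refine ⟨⟨?_, ?_⟩, ?_⟩
  · rintro ⟨l, hCl, hKl⟩
    obtain ⟨h2, g, H, rfl⟩ :=
      exists_parabolaPt_image_of_hyperfocused hC hKC (by omega) hCl hKl
    refine ⟨heven.2 h2, H, _, ⟨g.symm, fun P => rfl⟩, ?_⟩
    ext P
    constructor
    · rintro ⟨_, ⟨t, ht, rfl⟩, rfl⟩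
      exact ⟨t, ht, map_symm_parabolaPt g t⟩
    · rintro ⟨t, ht, rfl⟩
      exact ⟨_, ⟨t, ht, rfl⟩, map_symm_parabolaPt g t⟩
  · rintro ⟨hF, H, φ, ⟨g, hg⟩, himg⟩
    have h2 := heven.1 hF
    have hφ : φ = Projectivization.map g.symm.symm.toLinearMap g.symm.symm.injective := funext hg
    have hK : K = parabolaPt g.symm '' H := by
      apply Set.image_injective.2 (show Function.Injective φ from
        hφ ▸ Projectivization.map_injective _ g.symm.symm.injective)
      rw [himg, Set.image_image]
      ext P
      simp only [hφ, map_symm_parabolaPt]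
      exact ⟨fun ⟨t, ht, h⟩ => ⟨t, ht, h.symm⟩, fun ⟨t, ht, h⟩ => ⟨t, ht, h.symm⟩⟩
    subst hK
    rw [Set.ncard_image_of_injective _ (parabolaPt_injective _)] at hcard
    exact ⟨_, isTangentLine_lineAtInfinity h2 _ hcard hC hKC,
      hyperfocused_parabolaPt_image h2 _ H⟩
  · rintro ⟨l, hCl, hKl⟩
    obtain ⟨-, g, H, rfl⟩ :=
      exists_parabolaPt_image_of_hyperfocused hC hKC (by omega) hCl hKl
    rw [Set.ncard_image_of_injective _ (parabolaPt_injective g), ← Nat.card_eq_fintype_card]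
    exact H.card_addSubgroup_dvd_card
end

section
/- Let K be a translation k-arc in PG(2,q), q even, with k ≥ 2. Then there exists a blocking set of the secants of K of size exactly k−1 which is contained in the line l∞ of equation X3 = 0; equivalently, K is hyperfocused on l∞. -/
open scoped LinearAlgebra.Projectivization

variable {F : Type*} [Field F]

/-- The affine point with coordinates `(v.1, v.2, 1)`. -/
def affinePt (v : F × F) : PG2 F :=
  pt v.1 v.2 1 (mk3_ne_zero (Or.inr (Or.inr one_ne_zero)))

lemma dirVec_ne_zero {A : F × F} (hA : A ≠ 0) : (![A.1, A.2, 0] : Fin 3 → F) ≠ 0 := by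
  refine mk3_ne_zero ?_
  by_contra! h
  exact hA (Prod.ext h.1 h.2.1)

open Classical in
/-- The point at infinity in the direction `A` (with a default value at `A = 0`). -/
noncomputable def dirPt (A : F × F) : PG2 F :=
  if h : A ≠ 0 then pt A.1 A.2 0 (dirVec_ne_zero h)
  else pt 1 0 0 (mk3_ne_zero (Or.inl one_ne_zero))

lemma dirPt_of_ne_zero {A : F × F} (hA : A ≠ 0) :
    dirPt A = pt A.1 A.2 0 (dirVec_ne_zero hA) := dif_pos hA

lemma map_rep_mk_eq_zero_iff (f : (Fin 3 → F) →ₗ[F] F) (v : Fin 3 → F) (hv : v ≠ 0) :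
    f (Projectivization.mk F v hv).rep = 0 ↔ f v = 0 := by
  obtain ⟨a, ha⟩ := Projectivization.exists_smul_eq_mk_rep F v hv
  rw [← ha, Units.smul_def, map_smul, smul_eq_mul]
  simp

lemma affinePt_injective : Function.Injective (affinePt (F := F)) := by
  intro u v h
  obtain ⟨a, ha⟩ := (Projectivization.mk_eq_mk_iff' F _ _ _ _).1 h
  have h0 := congrFun ha 0
  have h1 := congrFun ha 1
  have h2 := congrFun ha 2
  simp only [Pi.smul_apply, smul_eq_mul, Matrix.cons_val_zero, Matrix.cons_val_one,
    Matrix.cons_val, mul_one] at h0 h1 h2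
  subst h2
  exact Prod.ext (by simpa using h0.symm) (by simpa using h1.symm)

lemma affinePt_add_injective (v : F × F) : Function.Injective fun A ↦ affinePt (v + A) :=
  affinePt_injective.comp (add_right_injective v)

lemma tφ_affinePt (A v : F × F) : tφ A (affinePt v) = affinePt (v + A) := by
  simp only [tφ, affinePt, pt, Projectivization.map_mk]
  congr 1
  funext i
  fin_cases i <;> simp [tEquiv]

lemma tφ_eq_self_of_rep_eq_zero (A : F × F) {P : PG2 F} (hP : P.rep 2 = 0) : tφ A P = P := by
  conv_lhs => rw [← P.mk_rep]
  conv_rhs => rw [← P.mk_rep]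
  simp only [tφ, Projectivization.map_mk]
  congr 1
  funext i
  fin_cases i <;> simp [tEquiv, hP]

lemma exists_eq_affinePt {P : PG2 F} (hP : P.rep 2 ≠ 0) : ∃ v, P = affinePt v := by
  refine ⟨(P.rep 0 / P.rep 2, P.rep 1 / P.rep 2), ?_⟩
  rw [affinePt, pt]
  conv_lhs => rw [← P.mk_rep]
  rw [Projectivization.mk_eq_mk_iff']
  refine ⟨P.rep 2, ?_⟩
  funext i
  fin_cases i <;> simp [mul_div_cancel₀, hP]

lemma tOrbit_affinePt (G : AddSubgroup (F × F)) (v : F × F) :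
    tOrbit G (affinePt v) = (fun A ↦ affinePt (v + A)) '' (G : Set (F × F)) := by
  ext Q
  simp [tOrbit, tφ_affinePt, eq_comm]

/-- The zero set of `X₃` is a line. -/
lemma isLine_infinity : IsLine {P : PG2 F | P.rep 2 = 0} := by
  refine ⟨LinearMap.proj 2, fun h ↦ ?_, rfl⟩
  simpa using LinearMap.congr_fun h ![0, 0, 1]

/-- The linear form vanishing on the affine point `v` and on the direction `d`. -/
def lineForm (v d : F × F) : (Fin 3 → F) →ₗ[F] F :=
  d.2 • LinearMap.proj 0 - d.1 • LinearMap.proj 1 - (d.2 * v.1 - d.1 * v.2) • LinearMap.proj 2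

lemma lineForm_apply (v d : F × F) (x : Fin 3 → F) :
    lineForm v d x = d.2 * x 0 - d.1 * x 1 - (d.2 * v.1 - d.1 * v.2) * x 2 := by
  simp [lineForm]

lemma lineForm_ne_zero (v : F × F) {d : F × F} (hd : d ≠ 0) : lineForm v d ≠ 0 := by
  intro h
  have h0 := LinearMap.congr_fun h ![1, 0, 0]
  have h1 := LinearMap.congr_fun h ![0, 1, 0]
  simp only [lineForm_apply] at h0 h1
  exact hd (Prod.ext (by simpa using h1) (by simpa using h0))

/-- The line through the affine point `v` with direction `d`. -/
def lineThrough (v d : F × F) : Set (PG2 F) := {P | lineForm v d P.rep = 0}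

lemma isLine_lineThrough (v : F × F) {d : F × F} (hd : d ≠ 0) : IsLine (lineThrough v d) :=
  ⟨_, lineForm_ne_zero v hd, rfl⟩

lemma affinePt_add_mem_lineThrough (v d A : F × F) :
    affinePt (v + A) ∈ lineThrough v d ↔ d.2 * A.1 = d.1 * A.2 := by
  rw [lineThrough, Set.mem_ofPred_eq, affinePt, pt, map_rep_mk_eq_zero_iff, lineForm_apply,
    ← sub_eq_zero (a := d.2 * A.1)]
  simp only [Prod.fst_add, Prod.snd_add, Matrix.cons_val_zero, Matrix.cons_val_one,
    Matrix.cons_val]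
  ring_nf

lemma dirPt_mem_lineThrough (v : F × F) {d : F × F} (hd : d ≠ 0) :
    dirPt d ∈ lineThrough v d := by
  rw [dirPt_of_ne_zero hd, lineThrough, Set.mem_ofPred_eq, pt, map_rep_mk_eq_zero_iff,
    lineForm_apply]
  simp
  ring

lemma dirPt_mem_infinity {A : F × F} (hA : A ≠ 0) : (dirPt A).rep 2 = 0 := by
  rw [dirPt_of_ne_zero hA, pt]
  exact (map_rep_mk_eq_zero_iff (LinearMap.proj 2) _ _).2 (by simp)

lemma affinePt_rep_ne_zero (v : F × F) : (affinePt v).rep 2 ≠ 0 := fun h ↦ by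
  simpa using (map_rep_mk_eq_zero_iff (LinearMap.proj 2) ![v.1, v.2, 1] _).1 h

lemma mul_eq_mul_of_dirPt_eq {A B : F × F} (hA : A ≠ 0) (hB : B ≠ 0) (h : dirPt A = dirPt B) :
    A.2 * B.1 = A.1 * B.2 := by
  rw [dirPt_of_ne_zero hA, dirPt_of_ne_zero hB] at h
  obtain ⟨a, ha⟩ := (Projectivization.mk_eq_mk_iff' F _ _ _ _).1 h
  have h0 := congrFun ha 0
  have h1 := congrFun ha 1
  simp only [Pi.smul_apply, smul_eq_mul, Matrix.cons_val_zero, Matrix.cons_val_one] at h0 h1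
  rw [← h0, ← h1]
  ring

lemma eq_dirPt_of_mul_eq_mul {P : PG2 F} (hP : P.rep 2 = 0) {d : F × F} (hd : d ≠ 0)
    (h : P.rep 0 * d.2 = P.rep 1 * d.1) : P = dirPt d := by
  rw [dirPt_of_ne_zero hd]
  conv_lhs => rw [← P.mk_rep]
  rw [pt, Projectivization.mk_eq_mk_iff']
  by_cases h1 : d.1 = 0
  · have h2 : d.2 ≠ 0 := fun h2 ↦ hd (Prod.ext h1 h2)
    have h0 : P.rep 0 = 0 := by simpa [h1, h2] using h
    refine ⟨P.rep 1 / d.2, ?_⟩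
    funext i
    fin_cases i <;> simp [h1, h2, h0, hP]
  · refine ⟨P.rep 0 / d.1, ?_⟩
    funext i
    fin_cases i
    · simp [h1]
    · simp only [Fin.mk_one, Pi.smul_apply, Matrix.cons_val_one, Matrix.cons_val_zero, smul_eq_mul]
      field_simp
      linear_combination h
    · simp [hP]

lemma apply_eq_coords (f : (Fin 3 → F) →ₗ[F] F) (x : Fin 3 → F) :
    f x = x 0 * f (Pi.single 0 1) + x 1 * f (Pi.single 1 1) + x 2 * f (Pi.single 2 1) := by
  rw [f.pi_apply_eq_sum_univ x, Fin.sum_univ_three]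
  simp only [smul_eq_mul]
  congr <;> · funext j; simp [Pi.single_apply, eq_comm]

/-- A line through two distinct affine points meets the line at infinity only in the point
given by their difference. -/
lemma eq_dirPt_sub {m : Set (PG2 F)} (hm : IsLine m) {u w : F × F} (huw : u ≠ w)
    (hu : affinePt u ∈ m) (hw : affinePt w ∈ m) {P : PG2 F} (hP : P.rep 2 = 0) (hPm : P ∈ m) :
    P = dirPt (u - w) := by
  obtain ⟨f, hf, rfl⟩ := hm
  replace hu := (map_rep_mk_eq_zero_iff f _ _).1 hu
  replace hw := (map_rep_mk_eq_zero_iff f _ _).1 hw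
  rw [Set.mem_ofPred_eq, apply_eq_coords, hP] at hPm
  rw [apply_eq_coords] at hu hw
  simp only [Matrix.cons_val_zero, Matrix.cons_val_one, Matrix.cons_val] at hu hw
  refine eq_dirPt_of_mul_eq_mul hP (sub_ne_zero.2 huw) (by_contra fun hne ↦ hf ?_)
  have hne' := sub_ne_zero.2 hne
  simp only [Prod.fst_sub, Prod.snd_sub] at hne'
  have h0 : f (Pi.single 0 1) = 0 := by
    refine (mul_eq_zero.1 ?_).resolve_left hne'
    linear_combination (u.2 - w.2) * hPm - P.rep 1 * (hu - hw)
  have h1 : f (Pi.single 1 1) = 0 := by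
    refine (mul_eq_zero.1 ?_).resolve_left hne'
    linear_combination - (u.1 - w.1) * hPm + P.rep 0 * (hu - hw)
  have h2 : f (Pi.single 2 1) = 0 := by simpa [h0, h1] using hu
  refine LinearMap.ext fun x ↦ ?_
  rw [apply_eq_coords]
  simp [h0, h1, h2]

lemma dirPt_mem {m : Set (PG2 F)} (hm : IsLine m) {u w : F × F} (huw : u ≠ w)
    (hu : affinePt u ∈ m) (hw : affinePt w ∈ m) : dirPt (u - w) ∈ m := by
  obtain ⟨f, hf, rfl⟩ := hm
  replace hu := (map_rep_mk_eq_zero_iff f _ _).1 hu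
  replace hw := (map_rep_mk_eq_zero_iff f _ _).1 hw
  rw [dirPt_of_ne_zero (sub_ne_zero.2 huw), Set.mem_ofPred_eq, pt, map_rep_mk_eq_zero_iff]
  rw [apply_eq_coords] at hu hw ⊢
  simp only [Matrix.cons_val_zero, Matrix.cons_val_one, Matrix.cons_val, Prod.fst_sub,
    Prod.snd_sub] at hu hw ⊢
  linear_combination hu - hw

lemma exists_affinePt_of_isSecant {G : AddSubgroup (F × F)} {v : F × F} {m : Set (PG2 F)}
    (hm : IsSecant (tOrbit G (affinePt v)) m) :
    ∃ A ∈ G, ∃ B ∈ G, A ≠ B ∧ affinePt (v + A) ∈ m ∧ affinePt (v + B) ∈ m := by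
  have hfin := Set.finite_of_ncard_pos (zero_lt_two.trans_le hm.2)
  obtain ⟨Q, R, ⟨hQ, hQm⟩, ⟨hR, hRm⟩, hne⟩ := (Set.one_lt_ncard_iff hfin).1 hm.2
  rw [tOrbit_affinePt] at hQ hR
  obtain ⟨A, hA, rfl⟩ := hQ
  obtain ⟨B, hB, rfl⟩ := hR
  exact ⟨A, hA, B, hB, fun h ↦ hne (h ▸ rfl), hQm, hRm⟩

lemma dirPt_injOn [Finite F] {G : AddSubgroup (F × F)} {v : F × F}
    (hK : IsArc (tOrbit G (affinePt v))) :
    Set.InjOn dirPt ((G : Set (F × F)) \ {0}) := by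
  rintro A ⟨hA, hA0⟩ B ⟨hB, hB0⟩ hAB
  rw [Set.mem_singleton_iff] at hA0 hB0
  by_contra hne
  have hle := hK _ (isLine_lineThrough v hA0)
  have hsub : (fun C ↦ affinePt (v + C)) '' {0, A, B} ⊆
      tOrbit G (affinePt v) ∩ lineThrough v A := by
    rw [tOrbit_affinePt]
    rintro _ ⟨C, hC, rfl⟩
    rcases hC with rfl | rfl | rfl
    · exact ⟨⟨0, G.zero_mem, rfl⟩, (affinePt_add_mem_lineThrough _ _ _).2 (by simp)⟩
    · exact ⟨⟨_, hA, rfl⟩, (affinePt_add_mem_lineThrough _ _ _).2 (mul_comm _ _)⟩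
    · exact ⟨⟨_, hB, rfl⟩,
        (affinePt_add_mem_lineThrough _ _ _).2 (mul_eq_mul_of_dirPt_eq hA0 hB0 hAB)⟩
  have : Finite (PG2 F) := inferInstance
  have hcard := Set.ncard_le_ncard hsub (Set.toFinite _)
  rw [Set.ncard_image_of_injective _ (affinePt_add_injective v),
    Set.ncard_eq_three.2 ⟨0, A, B, Ne.symm hA0, Ne.symm hB0, hne, rfl⟩] at hcard
  omega

lemma focusSet_tOrbit [Finite F] (G : AddSubgroup (F × F)) (v : F × F) :
    FocusSet (tOrbit G (affinePt v)) {P | P.rep 2 = 0} =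
      dirPt '' ((G : Set (F × F)) \ {0}) := by
  ext Q
  constructor
  · rintro ⟨hQ, m, hm, hQm⟩
    obtain ⟨A, hA, B, hB, hne, hAm, hBm⟩ := exists_affinePt_of_isSecant hm
    refine ⟨A - B, ⟨G.sub_mem hA hB, sub_ne_zero.2 hne⟩, ?_⟩
    rw [eq_dirPt_sub hm.1 (by simpa using hne) hAm hBm hQ hQm, add_sub_add_left_eq_sub]
  · rintro ⟨A, ⟨hA, hA0⟩, rfl⟩
    rw [Set.mem_singleton_iff] at hA0
    refine ⟨dirPt_mem_infinity hA0, lineThrough v A,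
      ⟨isLine_lineThrough v hA0, ?_⟩, dirPt_mem_lineThrough v hA0⟩
    have : Finite (PG2 F) := inferInstance
    refine (Set.one_lt_ncard_iff (Set.toFinite _)).2
      ⟨affinePt (v + 0), affinePt (v + A), ?_, ?_, ?_⟩
    · rw [tOrbit_affinePt]
      exact ⟨⟨0, G.zero_mem, rfl⟩, (affinePt_add_mem_lineThrough _ _ _).2 (by simp)⟩
    · rw [tOrbit_affinePt]
      exact ⟨⟨A, hA, rfl⟩, (affinePt_add_mem_lineThrough _ _ _).2 (mul_comm _ _)⟩
    · exact fun h ↦ hA0 (affinePt_add_injective v h).symm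

lemma exists_eq_affinePt_of_two_le_ncard {G : AddSubgroup (F × F)} {P : PG2 F}
    (h : 2 ≤ (tOrbit G P).ncard) : ∃ v, P = affinePt v := by
  refine exists_eq_affinePt fun hP ↦ ?_
  have hsub : tOrbit G P ⊆ {P} := by
    rintro _ ⟨A, -, rfl⟩
    exact tφ_eq_self_of_rep_eq_zero A hP
  have := Set.ncard_le_ncard hsub
  rw [Set.ncard_singleton] at this
  omega

/-- a translation `k`-arc (`k ≥ 2`, `q` even) admits a blocking
set of its secants of minimum size `k - 1` contained in the line `X₃ = 0`;
equivalently, it is hyperfocused on that line. -/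
theorem translationArc_hyperfocused_on_line_at_infinity
    {F : Type*} [Field F] [Fintype F] (hq : Even (Fintype.card F))
    (k : ℕ) (hk : 2 ≤ k) (K : Set (PG2 F))
    (hK : IsTranslationArc K) (hcard : K.ncard = k) :
    (∃ B : Set (PG2 F), IsBlockingSet K B ∧ B.ncard = k - 1 ∧
      B ⊆ {P : PG2 F | P.rep 2 = 0}) ∧
    Hyperfocused K {P : PG2 F | P.rep 2 = 0} := by
  subst hcard
  obtain ⟨hArc, G, P, rfl⟩ := hK
  obtain ⟨v, rfl⟩ := exists_eq_affinePt_of_two_le_ncard hk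
  have hdisj : tOrbit G (affinePt v) ∩ {P : PG2 F | P.rep 2 = 0} = ∅ := by
    rw [tOrbit_affinePt, Set.eq_empty_iff_forall_notMem]
    rintro _ ⟨⟨A, -, rfl⟩, h⟩
    exact affinePt_rep_ne_zero _ h
  have hfocus : (FocusSet (tOrbit G (affinePt v)) {P : PG2 F | P.rep 2 = 0}).ncard =
      (tOrbit G (affinePt v)).ncard - 1 := by
    rw [focusSet_tOrbit, (dirPt_injOn hArc).ncard_image, tOrbit_affinePt,
      Set.ncard_image_of_injective _ (affinePt_add_injective v),
      Set.ncard_sdiff_singleton_of_mem G.zero_mem]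
  refine ⟨⟨_, ⟨?_, fun m hm ↦ ?_⟩, hfocus, fun _ h ↦ h.1⟩, isLine_infinity, hdisj, hfocus⟩
  · refine Set.subset_empty_iff.1 (hdisj ▸ ?_)
    exact fun Q hQ ↦ ⟨hQ.2, hQ.1.1⟩
  · obtain ⟨A, hA, B, hB, hne, hAm, hBm⟩ := exists_affinePt_of_isSecant hm
    have hne' : v + A ≠ v + B := by simpa using hne
    have hmem := dirPt_mem hm.1 hne' hAm hBm
    exact ⟨_, ⟨dirPt_mem_infinity (sub_ne_zero.2 hne'), m, hm, hmem⟩, hmem⟩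
end

section
/- Let q = 2^s, let H be an additive subgroup of F_q, and let G = {(α, α²) : α ∈ H} ⊆ F_q × F_q. Then for any point P off the line X3 = 0, the orbit K_G(P) is a translation arc, i.e., it is an arc (no three of its points are collinear). -/
open scoped LinearAlgebra.Projectivization

variable {F : Type*} [Field F]

open Polynomial in
lemma ncard_quadratic_roots_le_two {F : Type*} [Field F] {a b c : F}
    (h : a ≠ 0 ∨ b ≠ 0 ∨ c ≠ 0) :
    {x : F | a * x ^ 2 + b * x + c = 0}.Finite ∧
      {x : F | a * x ^ 2 + b * x + c = 0}.ncard ≤ 2 := by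
  classical
  set p : F[X] := C a * X ^ 2 + C b * X + C c with hp
  have hp0 : p ≠ 0 := by
    intro h0
    have h2 := congrArg (fun r : F[X] => r.coeff 2) h0
    have h1 := congrArg (fun r : F[X] => r.coeff 1) h0
    have h00 := congrArg (fun r : F[X] => r.coeff 0) h0
    simp [hp, coeff_X, coeff_C] at h2 h1 h00
    tauto
  have hset : {x : F | a * x ^ 2 + b * x + c = 0} = (p.roots.toFinset : Set F) := by
    ext x
    rw [Finset.mem_coe, Multiset.mem_toFinset, mem_roots hp0]
    simp [hp]
  rw [hset, Set.ncard_coe_finset]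
  exact ⟨Finset.finite_toSet _, (Multiset.toFinset_card_le _).trans
    ((card_roots' p).trans natDegree_quadratic_le)⟩

lemma linearMap_rep_tφ_eq_zero_iff {F : Type*} [Field F] (f : (Fin 3 → F) →ₗ[F] F)
    (A : F × F) (P : PG2 F) :
    f (tφ A P).rep = 0 ↔ f (tEquiv A P.rep) = 0 := by
  have hne : tEquiv A P.rep ≠ 0 := by simpa using P.rep_nonzero
  have hmk : tφ A P = Projectivization.mk F (tEquiv A P.rep) hne := by
    conv_lhs => rw [← P.mk_rep]
    rfl
  obtain ⟨u, hu⟩ := Projectivization.exists_smul_eq_mk_rep F (tEquiv A P.rep) hne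
  rw [hmk, ← hu, Units.smul_def, map_smul]
  simp

lemma linearMap_fin_three_apply {F : Type*} [Field F] (f : (Fin 3 → F) →ₗ[F] F)
    (v : Fin 3 → F) :
    f v = v 0 * f (Pi.single 0 1) + v 1 * f (Pi.single 1 1) + v 2 * f (Pi.single 2 1) := by
  conv_lhs => rw [← Finset.univ_sum_single v, map_sum, Fin.sum_univ_three]
  have h (i : Fin 3) : f (Pi.single i (v i)) = v i * f (Pi.single i 1) := by
    rw [← smul_eq_mul, ← map_smul, ← Pi.single_smul, smul_eq_mul, mul_one]
  rw [h, h, h]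

/-- for `q = 2^s`, `H` an additive subgroup of `F_q`,
`G = {(α, α²) : α ∈ H}`, and `P` off the line `X₃ = 0`, the orbit `K_G(P)`
is an arc (hence a translation arc). -/
theorem orbit_alpha_alphaSq_isArc {F : Type*} [Field F] [Fintype F]
    (s : ℕ) (hs : Fintype.card F = 2 ^ s) (H : AddSubgroup F)
    (P : PG2 F) (hP : P.rep 2 ≠ 0) :
    IsArc {Q : PG2 F | ∃ α ∈ H, Q = tφ (α, α ^ 2) P} := by
  rintro l ⟨f, hf, rfl⟩
  set a := P.rep 2 * f (Pi.single 1 1) with ha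
  set b := P.rep 2 * f (Pi.single 0 1) with hb
  have habc : a ≠ 0 ∨ b ≠ 0 ∨ f P.rep ≠ 0 := by
    by_contra! h
    obtain ⟨h1, h0, h2⟩ := h
    have h1 := (mul_eq_zero.mp h1).resolve_left hP
    have h0 := (mul_eq_zero.mp h0).resolve_left hP
    rw [linearMap_fin_three_apply, h0, h1, mul_zero, mul_zero, zero_add, zero_add] at h2
    have h2 := (mul_eq_zero.mp h2).resolve_left hP
    refine hf (LinearMap.ext fun v => ?_)
    rw [linearMap_fin_three_apply, h0, h1, h2]
    simp
  obtain ⟨hfin, hcard⟩ := ncard_quadratic_roots_le_two habc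
  refine (Set.ncard_le_ncard ?_ (hfin.image fun α => tφ (α, α ^ 2) P)).trans
    ((Set.ncard_image_le hfin).trans hcard)
  rintro _ ⟨⟨α, -, rfl⟩, hα⟩
  refine ⟨α, ?_, rfl⟩
  have hα := (linearMap_rep_tφ_eq_zero_iff f _ P).mp hα
  rw [linearMap_fin_three_apply] at hα
  simp only [tEquiv, LinearEquiv.coe_mk, LinearMap.coe_mk, AddHom.coe_mk,
    Matrix.cons_val] at hα
  rw [Set.mem_ofPred_eq, ← hα, linearMap_fin_three_apply f P.rep, ha, hb]
  ring
end
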